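/- arXiv:1012.3396 — 3 statements merged into one kernel-verified Lean document; each statement's English description precedes it below -/
import Mathlib

section
/- Let M = (m_{ij}) be an n×n matrix of integers. Then M is homogeneous (i.e. every 2×2 submatrix of M satisfies m_{ij} + m_{i'j'} = m_{ij'} + m_{i'j}) if and only if there is an integer d such that for every permutation σ of {1,...,n} one has m_{1σ(1)} + m_{2σ(2)} + ... + m_{nσ(n)} = d. -/
open MvPolynomial Matrix

/-- `f` is a form of degree `m : ℤ` -/
def IsFormOfDeg {k : ℕ} (f : MvPolynomial (Fin k) ℂ) (m : ℤ) : Prop :=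
  if m < 0 then f = 0 else f.IsHomogeneous m.toNat

def HasDegMatrix {k a b : ℕ} (N : Matrix (Fin a) (Fin b) (MvPolynomial (Fin k) ℂ))
    (M : Matrix (Fin a) (Fin b) ℤ) : Prop :=
  ∀ i j, IsFormOfDeg (N i j) (M i j)

def IsHomogMatrix {a b : ℕ} (M : Matrix (Fin a) (Fin b) ℤ) : Prop :=
  ∀ (i i' : Fin a) (j j' : Fin b), i < i' → j < j' →
    M i j + M i' j' = M i j' + M i' j

def WellOrderedMatrix {a b : ℕ} (M : Matrix (Fin a) (Fin b) ℤ) : Prop :=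
  (∀ (i i' : Fin a) (j : Fin b), i ≤ i' → M i' j ≤ M i j) ∧
  (∀ (i : Fin a) (j j' : Fin b), j ≤ j' → M i j ≤ M i j')

/-- A property `P` holds for a general form of degree `d` in `k` variables. -/
def GeneralForm (k : ℕ) (d : ℤ) (P : MvPolynomial (Fin k) ℂ → Prop) : Prop :=
  ∃ Φ : MvPolynomial ((Fin k) →₀ ℕ) ℂ,
    (∃ f : MvPolynomial (Fin k) ℂ, IsFormOfDeg f d ∧ eval f.coeff Φ ≠ 0) ∧
    ∀ f : MvPolynomial (Fin k) ℂ, IsFormOfDeg f d → eval f.coeff Φ ≠ 0 → P f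

noncomputable def minorsIdeal {k n : ℕ} (A : Matrix (Fin n) (Fin (n+1)) (MvPolynomial (Fin k) ℂ)) :
    Ideal (MvPolynomial (Fin k) ℂ) :=
  Ideal.span (Set.range fun j : Fin (n+1) => (A.submatrix id j.succAbove).det)

def IsZeroDimIdeal (I : Ideal (MvPolynomial (Fin 3) ℂ)) : Prop :=
  ringKrullDim (MvPolynomial (Fin 3) ℂ ⧸ I) = 1

noncomputable def hilbFn (I : Ideal (MvPolynomial (Fin 3) ℂ)) (t : ℕ) : ℕ :=
  Module.finrank ℂ (homogeneousSubmodule (Fin 3) ℂ t) -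
    Module.finrank ℂ
      (Submodule.restrictScalars ℂ I ⊓ homogeneousSubmodule (Fin 3) ℂ t : Submodule ℂ _)

noncomputable def hilbFnZ (I : Ideal (MvPolynomial (Fin 3) ℂ)) (t : ℤ) : ℕ :=
  if t < 0 then 0 else hilbFn I t.toNat

def Cond2 {n : ℕ} (M : Matrix (Fin n) (Fin n) ℤ) : Prop :=
  ∀ (t : ℕ) (_ : 1 ≤ t) (h2 : t < n),
    M ⟨t, h2⟩ ⟨t - 1, by omega⟩ < 0 →
      ((∑ i : Fin (n - t), M ⟨t + i.1, by have := i.2; omega⟩ ⟨t + i.1, by have := i.2; omega⟩) = 0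
        ∨ (∑ i : Fin (n - t), M ⟨t + i.1, by have := i.2; omega⟩ ⟨t + i.1, by have := i.2; omega⟩)
            = ∑ i, M i i)

theorem IsHomogMatrix.add_eq_add {a b : ℕ} {M : Matrix (Fin a) (Fin b) ℤ} (hM : IsHomogMatrix M)
    (i i' : Fin a) (j j' : Fin b) : M i j + M i' j' = M i j' + M i' j := by
  rcases lt_trichotomy i i' with hi | rfl | hi
  · rcases lt_trichotomy j j' with hj | rfl | hj
    · exact hM i i' j j' hi hj
    · rfl
    · exact (hM i i' j' j hi hj).symm
  · exact add_comm _ _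
  · rcases lt_trichotomy j j' with hj | rfl | hj
    · linarith [hM i' i j j' hi hj]
    · rfl
    · linarith [hM i' i j' j hi hj]

theorem IsHomogMatrix.sum_perm_eq_sum_diag {n : ℕ} {M : Matrix (Fin n) (Fin n) ℤ}
    (hM : IsHomogMatrix M) (σ : Equiv.Perm (Fin n)) : ∑ i, M i (σ i) = ∑ i, M i i := by
  cases n with
  | zero => simp
  | succ n =>
    have h (i j : Fin (n + 1)) : M i j = M i 0 + M 0 j - M 0 0 := by
      linarith [hM.add_eq_add i 0 j 0]
    rw [Finset.sum_congr rfl fun i _ => h i (σ i), Finset.sum_congr rfl fun i _ => h i i]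
    simp only [Finset.sum_sub_distrib, Finset.sum_add_distrib, Equiv.sum_comp σ fun j => M 0 j]

theorem Equiv.Perm.exists_apply_eq_and_apply_eq {α : Type*} [DecidableEq α] {i i' j j' : α}
    (hi : i ≠ i') (hj : j ≠ j') : ∃ σ : Equiv.Perm α, σ i = j ∧ σ i' = j' := by
  refine ⟨(Equiv.swap i j).trans (Equiv.swap (Equiv.swap i j i') j'), ?_, ?_⟩
  · have h : j ≠ Equiv.swap i j i' := fun h =>
      hi ((Equiv.swap i j).injective ((Equiv.swap_apply_left i j).trans h))
    rw [Equiv.trans_apply, Equiv.swap_apply_left, Equiv.swap_apply_of_ne_of_ne h hj]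
  · rw [Equiv.trans_apply, Equiv.swap_apply_left]

/-- An `n×n` integer matrix is homogeneous (every `2×2` submatrix is homogeneous) iff
all its permutation sums are equal to a common value `d`. -/
theorem stmt_0 {n : ℕ} (M : Matrix (Fin n) (Fin n) ℤ) :
    IsHomogMatrix M ↔ ∃ d : ℤ, ∀ σ : Equiv.Perm (Fin n), (∑ i, M i (σ i)) = d := by
  constructor
  · exact fun hM => ⟨∑ i, M i i, hM.sum_perm_eq_sum_diag⟩
  · rintro ⟨d, hd⟩ i i' j j' hi hj
    obtain ⟨σ, rfl, rfl⟩ := Equiv.Perm.exists_apply_eq_and_apply_eq hi.ne hj.ne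
    have h : ∑ k, (M k (σ k) - M k ((σ * Equiv.swap i i') k)) = 0 := by
      rw [Finset.sum_sub_distrib, hd, hd, sub_self]
    rw [Fintype.sum_eq_add i i' hi.ne fun k hk => by
      rw [Equiv.Perm.mul_apply, Equiv.swap_apply_of_ne_of_ne hk.1 hk.2, sub_self]] at h
    simp only [Equiv.Perm.mul_apply, Equiv.swap_apply_left, Equiv.swap_apply_right] at h
    linarith
end

section
/- Let M = (m_{ij}) be a well-ordered homogeneous n×n matrix of integers of degree d, and suppose m_{k,k−1} < 0 for some k ∈ {2,...,n}. Let N = (f_{ij}) be any matrix of forms in C[x_0,x_1,x_2] with degree matrix M, let N' be the top-left (k−1)×(k−1) block of N and N'' the bottom-right (n−k+1)×(n−k+1) block. Then det(N) = det(N')·det(N''), where det(N') is homogeneous of degree e (the degree of the top-left (k−1)×(k−1) submatrix M' of M) and det(N'') is homogeneous of degree d−e. Consequently, if 0 < e < d, then det(N) is not an irreducible polynomial. -/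
open MvPolynomial Matrix

theorem IsFormOfDeg.zero {k : ℕ} (m : ℤ) : IsFormOfDeg (0 : MvPolynomial (Fin k) ℂ) m := by
  unfold IsFormOfDeg
  split_ifs
  · rfl
  · exact isHomogeneous_zero _ _ _

theorem IsFormOfDeg.add {k : ℕ} {f g : MvPolynomial (Fin k) ℂ} {m : ℤ}
    (hf : IsFormOfDeg f m) (hg : IsFormOfDeg g m) : IsFormOfDeg (f + g) m := by
  unfold IsFormOfDeg at *
  split_ifs at *
  · simp [hf, hg]
  · exact IsHomogeneous.add hf hg

theorem IsFormOfDeg.neg {k : ℕ} {f : MvPolynomial (Fin k) ℂ} {m : ℤ}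
    (hf : IsFormOfDeg f m) : IsFormOfDeg (-f) m := by
  unfold IsFormOfDeg at *
  split_ifs at *
  · simp [hf]
  · exact (homogeneousSubmodule (Fin k) ℂ m.toNat).neg_mem hf

theorem IsFormOfDeg.sum {k : ℕ} {ι : Type*} {s : Finset ι} {f : ι → MvPolynomial (Fin k) ℂ}
    {m : ℤ} (h : ∀ i ∈ s, IsFormOfDeg (f i) m) : IsFormOfDeg (∑ i ∈ s, f i) m :=
  Finset.sum_induction _ (IsFormOfDeg · m) (fun _ _ => IsFormOfDeg.add) (IsFormOfDeg.zero m) h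

theorem IsFormOfDeg.mul {k : ℕ} {f g : MvPolynomial (Fin k) ℂ} {m l : ℤ}
    (hf : IsFormOfDeg f m) (hg : IsFormOfDeg g l) : IsFormOfDeg (f * g) (m + l) := by
  by_cases hm : m < 0
  · rw [IsFormOfDeg, if_pos hm] at hf
    simpa [hf] using IsFormOfDeg.zero (m + l)
  by_cases hl : l < 0
  · rw [IsFormOfDeg, if_pos hl] at hg
    simpa [hg] using IsFormOfDeg.zero (m + l)
  rw [IsFormOfDeg, if_neg hm] at hf
  rw [IsFormOfDeg, if_neg hl] at hg
  rw [IsFormOfDeg, if_neg (by omega), Int.toNat_add (by omega) (by omega)]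
  exact hf.mul hg

theorem IsFormOfDeg.prod {k : ℕ} {ι : Type*} (s : Finset ι) {f : ι → MvPolynomial (Fin k) ℂ}
    {m : ι → ℤ} (h : ∀ i, IsFormOfDeg (f i) (m i)) :
    IsFormOfDeg (∏ i ∈ s, f i) (∑ i ∈ s, m i) := by
  classical
  induction s using Finset.induction_on with
  | empty => simpa [IsFormOfDeg] using isHomogeneous_one (Fin k) ℂ
  | insert a s ha ih =>
    rw [Finset.prod_insert ha, Finset.sum_insert ha]
    exact (h a).mul ih

/-- The determinant of a matrix of forms of degrees `r i + c j` is a form. -/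
theorem IsFormOfDeg.det {k a : ℕ} {A : Matrix (Fin a) (Fin a) (MvPolynomial (Fin k) ℂ)}
    {r c : Fin a → ℤ} (h : ∀ i j, IsFormOfDeg (A i j) (r i + c j)) :
    IsFormOfDeg A.det (∑ i, (r i + c i)) := by
  rw [Matrix.det_apply]
  refine IsFormOfDeg.sum fun σ _ => ?_
  have hp : IsFormOfDeg (∏ i, A (σ i) i) (∑ i, (r i + c i)) := by
    have h' := IsFormOfDeg.prod Finset.univ fun i => h (σ i) i
    rwa [Finset.sum_add_distrib, Equiv.sum_comp σ r, ← Finset.sum_add_distrib] at h'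
  rcases Int.units_eq_one_or (Equiv.Perm.sign σ) with hs | hs <;> rw [hs]
  · simpa using hp
  · simpa using hp.neg

theorem IsFormOfDeg.not_isUnit {k : ℕ} {f : MvPolynomial (Fin k) ℂ} {m : ℤ}
    (hf : IsFormOfDeg f m) (hm : 0 < m) : ¬ IsUnit f := by
  rw [IsFormOfDeg, if_neg (by omega)] at hf
  intro hu
  have h0 : constantCoeff f = 0 := hf.coeff_eq_zero (by simp; omega)
  exact (hu.map constantCoeff).ne_zero h0

theorem IsHomogMatrix.exists_add {a b : ℕ} {M : Matrix (Fin a) (Fin b) ℤ} (hM : IsHomogMatrix M)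
    (i₀ : Fin a) (j₀ : Fin b) : ∃ (r : Fin a → ℤ) (c : Fin b → ℤ), ∀ i j, M i j = r i + c j := by
  refine ⟨fun i => M i j₀, fun j => M i₀ j - M i₀ j₀, fun i j => ?_⟩
  dsimp only
  rcases lt_trichotomy i i₀ with hi | rfl | hi <;> rcases lt_trichotomy j j₀ with hj | rfl | hj
  · have := hM _ _ _ _ hi hj; omega
  · ring
  · have := hM _ _ _ _ hi hj; omega
  · ring
  · ring
  · ring
  · have := hM _ _ _ _ hi hj; omega
  · ring
  · have := hM _ _ _ _ hi hj; omega

/-- If `M` is homogeneous well-ordered of degree `d` with a negative entry `m_{k,k-1}`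
on the subdiagonal (here `t = k - 1` in 0-based indexing), then for any matrix of forms
`N` with degree matrix `M`, `det N = det N' * det N''` where `N'` is the top-left `t×t`
block and `N''` the bottom-right `(n-t)×(n-t)` block, `det N'` is a form of degree `e`
(the degree of the corresponding block of `M`), `det N''` a form of degree `d - e`, and
if `0 < e < d` then `det N` is not irreducible. -/
theorem stmt_3 {n : ℕ} (M : Matrix (Fin n) (Fin n) ℤ)
    (hM : IsHomogMatrix M) (hMw : WellOrderedMatrix M)
    (d : ℤ) (hd : d = ∑ i, M i i)
    (t : ℕ) (ht1 : 1 ≤ t) (htn : t < n)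
    (hsub : M ⟨t, htn⟩ ⟨t - 1, by omega⟩ < 0)
    (N : Matrix (Fin n) (Fin n) (MvPolynomial (Fin 3) ℂ)) (hN : HasDegMatrix N M)
    (N' : Matrix (Fin t) (Fin t) (MvPolynomial (Fin 3) ℂ))
    (hN' : ∀ i j : Fin t, N' i j = N ⟨i.1, by have := i.2; omega⟩ ⟨j.1, by have := j.2; omega⟩)
    (N'' : Matrix (Fin (n - t)) (Fin (n - t)) (MvPolynomial (Fin 3) ℂ))
    (hN'' : ∀ i j : Fin (n - t),
      N'' i j = N ⟨t + i.1, by have := i.2; omega⟩ ⟨t + j.1, by have := j.2; omega⟩)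
    (e : ℤ) (he : e = ∑ i : Fin t, M ⟨i.1, by have := i.2; omega⟩ ⟨i.1, by have := i.2; omega⟩) :
    N.det = N'.det * N''.det ∧
    IsFormOfDeg N'.det e ∧
    IsFormOfDeg N''.det (d - e) ∧
    (0 < e → e < d → ¬ Irreducible N.det) := by
  obtain ⟨r, c, hrc⟩ := hM.exists_add ⟨t, htn⟩ ⟨t, htn⟩
  let ε : Fin t ⊕ Fin (n - t) ≃ Fin n := finSumFinEquiv.trans (finCongr (by omega))
  have hdet : N.det = N'.det * N''.det := by
    rw [← Matrix.det_submatrix_equiv_self ε N, ← Matrix.fromBlocks_toBlocks (N.submatrix ε ε)]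
    have h₂₁ : (N.submatrix ε ε).toBlocks₂₁ = 0 := by
      ext1 i j
      have hneg : M (ε (Sum.inr i)) (ε (Sum.inl j)) < 0 :=
        ((hMw.1 ⟨t, htn⟩ _ _ (Fin.le_def.2 (Nat.le_add_right t i))).trans
          (hMw.2 _ _ _ (Fin.le_def.2 (Nat.le_sub_one_of_lt j.2)))).trans_lt hsub
      have h := hN (ε (Sum.inr i)) (ε (Sum.inl j))
      rwa [IsFormOfDeg, if_pos hneg] at h
    have h₁₁ : (N.submatrix ε ε).toBlocks₁₁ = N' := by
      ext1 i j
      exact (hN' i j).symm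
    have h₂₂ : (N.submatrix ε ε).toBlocks₂₂ = N'' := by
      ext1 i j
      exact (hN'' i j).symm
    rw [h₂₁, h₁₁, h₂₂, Matrix.det_fromBlocks_zero₂₁]
  have hform' : IsFormOfDeg N'.det e := by
    have h := IsFormOfDeg.det (A := N') (r := fun i => r (ε (Sum.inl i)))
      (c := fun i => c (ε (Sum.inl i))) fun i j => by
        rw [hN', ← hrc]
        exact hN _ _
    simp only [← hrc] at h
    rw [he]
    exact h
  have hform'' : IsFormOfDeg N''.det (d - e) := by
    have h := IsFormOfDeg.det (A := N'') (r := fun i => r (ε (Sum.inr i)))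
      (c := fun i => c (ε (Sum.inr i))) fun i j => by
        rw [hN'', ← hrc]
        exact hN _ _
    simp only [← hrc] at h
    have hsum : d = e + ∑ i, M (ε (Sum.inr i)) (ε (Sum.inr i)) := by
      rw [hd, he, ← Equiv.sum_comp ε, Fintype.sum_sum_type]
      rfl
    rwa [hsum, add_sub_cancel_left]
  refine ⟨hdet, hform', hform'', fun h0 hlt hirr => ?_⟩
  exact (hirr.isUnit_or_isUnit hdet).elim (hform'.not_isUnit h0) (hform''.not_isUnit (by omega))
end

section
/- Let Q be a homogeneous (n−1)×n matrix of integers which is a dHB matrix of zero-dimensional subschemes Z of P^2; all such Z have the same degree δ and the same Hilbert function Hf. Assume that Hf(d) = δ and that a general plane curve of degree d contains a zero-dimensional subscheme with dHB matrix Q. Then for every d' ≥ d, a general plane curve of degree d' also contains a zero-dimensional subscheme with dHB matrix Q. -/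
open MvPolynomial Matrix

open KaehlerDifferential in
lemma linearIndependent_D_of_algebraicIndependent {ι K : Type} [Field K] [Algebra ℂ K]
    [Algebra.EssFiniteType ℂ K] {p : ι → K} (hp : AlgebraicIndependent ℂ p) :
    LinearIndependent K (fun i => D ℂ K (p i)) := by
  let : Algebra (MvPolynomial ι ℂ) K := (aeval p).toRingHom.toAlgebra
  have hmap : ∀ x, algebraMap (MvPolynomial ι ℂ) K x = aeval p x := fun _ => rfl
  have : IsScalarTower ℂ (MvPolynomial ι ℂ) K :=
    IsScalarTower.of_algebraMap_eq fun x => by rw [hmap]; simp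
  have : FaithfulSMul (MvPolynomial ι ℂ) K := by
    rw [faithfulSMul_iff_algebraMap_injective]; exact hp
  let : Algebra (FractionRing (MvPolynomial ι ℂ)) K := FractionRing.liftAlgebra _ _
  have : IsScalarTower ℂ (FractionRing (MvPolynomial ι ℂ)) K :=
    IsScalarTower.of_algebraMap_eq fun x => by
      rw [IsScalarTower.algebraMap_apply ℂ (MvPolynomial ι ℂ) K,
        IsScalarTower.algebraMap_apply ℂ (MvPolynomial ι ℂ) (FractionRing (MvPolynomial ι ℂ)),
        ← IsScalarTower.algebraMap_apply (MvPolynomial ι ℂ) (FractionRing (MvPolynomial ι ℂ)) K]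
  have : CharZero (FractionRing (MvPolynomial ι ℂ)) :=
    algebraRat.charZero _
  have : Algebra.EssFiniteType (FractionRing (MvPolynomial ι ℂ)) K :=
    Algebra.EssFiniteType.of_comp ℂ _ _
  have : Algebra.FormallySmooth (MvPolynomial ι ℂ) (FractionRing (MvPolynomial ι ℂ)) :=
    .of_isLocalization (nonZeroDivisors _)
  have : Algebra.FormallySmooth (MvPolynomial ι ℂ) K :=
    .comp _ (FractionRing (MvPolynomial ι ℂ)) _
  have hinj : Function.Injective (mapBaseChange ℂ (MvPolynomial ι ℂ) K) := by
    rw [injective_iff_map_eq_zero]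
    intro x hx
    obtain ⟨y, rfl⟩ := (Algebra.H1Cotangent.exact_δ_mapBaseChange ℂ (MvPolynomial ι ℂ) K x).mp hx
    rw [Subsingleton.elim y 0, map_zero]
  have h := (((mvPolynomialBasis ℂ ι).baseChange K).linearIndependent.map' _
    (LinearMap.ker_eq_bot.2 hinj))
  have heq : (fun i => D ℂ K (p i)) = mapBaseChange ℂ (MvPolynomial ι ℂ) K ∘
      (mvPolynomialBasis ℂ ι).baseChange K := by
    ext i
    simp [mvPolynomialBasis_apply, mapBaseChange_tmul, hmap]
  rw [heq]
  exact h

/-- The Jacobian matrix of a family of polynomials. -/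
noncomputable def jacobianMatrix {ι τ : Type} (P : ι → MvPolynomial τ ℂ) :
    Matrix ι τ (MvPolynomial τ ℂ) :=
  Matrix.of fun s l => pderiv l (P s)

open KaehlerDifferential in
lemma D_algebraMap_mvPolynomial {τ K : Type} [Fintype τ] [Field K] [Algebra ℂ K]
    [Algebra (MvPolynomial τ ℂ) K] [IsScalarTower ℂ (MvPolynomial τ ℂ) K]
    (f : MvPolynomial τ ℂ) :
    D ℂ K (algebraMap _ K f) =
      ∑ l, algebraMap _ K (pderiv l f) • D ℂ K (algebraMap _ K (X l : MvPolynomial τ ℂ)) := by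
  classical
  induction f using MvPolynomial.induction_on with
  | C a =>
    have : algebraMap (MvPolynomial τ ℂ) K (C a) = algebraMap ℂ K a := by
      rw [IsScalarTower.algebraMap_apply ℂ (MvPolynomial τ ℂ) K]; rfl
    simp [this]
  | add p q hp hq => simp [hp, hq, add_smul, Finset.sum_add_distrib]
  | mul_X p i hp =>
    simp only [map_mul, Derivation.leibniz, hp, pderiv_X, smul_eq_mul, map_add, add_smul,
      Finset.sum_add_distrib, Finset.smul_sum, smul_smul]
    congr 1
    rw [Finset.sum_eq_single i] <;> simp +contextual [eq_comm]

lemma exists_jacobianMatrix_mul_eq_smul_one {ι τ : Type} [Fintype ι] [Fintype τ] [DecidableEq ι]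
    {P : ι → MvPolynomial τ ℂ} (hP : AlgebraicIndependent ℂ P) :
    ∃ q : MvPolynomial τ ℂ, q ≠ 0 ∧ ∃ W : Matrix τ ι (MvPolynomial τ ℂ),
      jacobianMatrix P * W = q • (1 : Matrix ι ι (MvPolynomial τ ℂ)) := by
  classical
  let K := FractionRing (MvPolynomial τ ℂ)
  have hinj : Function.Injective (algebraMap (MvPolynomial τ ℂ) K) :=
    IsFractionRing.injective _ _
  have : Algebra.EssFiniteType (MvPolynomial τ ℂ) K := .of_isLocalization K (nonZeroDivisors _)
  have : Algebra.EssFiniteType ℂ K := .comp ℂ (MvPolynomial τ ℂ) K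
  have hp : AlgebraicIndependent ℂ (fun s => algebraMap (MvPolynomial τ ℂ) K (P s)) :=
    hP.map' (f := IsScalarTower.toAlgHom ℂ (MvPolynomial τ ℂ) K) hinj
  have hli := linearIndependent_D_of_algebraicIndependent hp
  let J : Matrix ι τ K := (jacobianMatrix P).map (algebraMap _ K)
  have hrow : LinearIndependent K J.row := by
    rw [Fintype.linearIndependent_iff] at hli ⊢
    intro g hg
    refine hli g ?_
    simp_rw [fun i => D_algebraMap_mvPolynomial (K := K) (P i), Finset.smul_sum, smul_smul]
    rw [Finset.sum_comm]
    refine Finset.sum_eq_zero fun l _ => ?_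
    rw [← Finset.sum_smul]
    have := congrFun hg l
    simp only [Finset.sum_apply, Pi.smul_apply, smul_eq_mul, Pi.zero_apply] at this
    have h2 : ∑ i, g i * algebraMap (MvPolynomial τ ℂ) K (pderiv l (P i)) = 0 := this
    rw [h2, zero_smul]
  have hsurj : Function.Surjective J.mulVec := by
    have h1 := hrow.rank_matrix
    have : LinearMap.range J.mulVecLin = ⊤ := by
      apply Submodule.eq_top_of_finrank_eq
      rw [Module.finrank_fintype_fun_eq_card]
      exact h1
    exact LinearMap.range_eq_top.1 this
  obtain ⟨X, hX⟩ := Matrix.mulVec_surjective_iff_exists_right_inverse.1 hsurj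
  obtain ⟨b, hb⟩ := IsLocalization.exist_integer_multiples_of_finite
    (nonZeroDivisors (MvPolynomial τ ℂ)) (fun x : τ × ι => X x.1 x.2)
  choose W hW using hb
  let V : Matrix τ ι (MvPolynomial τ ℂ) := Matrix.of fun t s => W (t, s)
  refine ⟨b, nonZeroDivisors.ne_zero b.2, V, ?_⟩
  have hWm : V.map (algebraMap _ K) =
      algebraMap (MvPolynomial τ ℂ) K b • X := by
    ext t s
    simpa [Algebra.smul_def, V] using hW (t, s)
  apply Matrix.map_injective hinj
  change (jacobianMatrix P * V).map _ = _
  rw [Matrix.map_mul, hWm]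
  change J * (algebraMap (MvPolynomial τ ℂ) K b • X) = _
  rw [Matrix.mul_smul, hX]
  ext i j
  by_cases hij : i = j <;> simp [hij]

lemma exists_eval_jacobianMatrix_mul_eq_one {ι τ : Type} [Fintype ι] [Fintype τ] [DecidableEq ι]
    {P : ι → MvPolynomial τ ℂ} (hP : AlgebraicIndependent ℂ P) {h : MvPolynomial τ ℂ}
    (hh : h ≠ 0) :
    ∃ v : τ → ℂ, eval v h ≠ 0 ∧ ∃ W : Matrix τ ι ℂ, (jacobianMatrix P).map (eval v) * W = 1 := by
  obtain ⟨q, hq, W, hW⟩ := exists_jacobianMatrix_mul_eq_smul_one hP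
  have : ∃ v : τ → ℂ, eval v (h * q) ≠ 0 := by
    by_contra! hcon
    exact mul_ne_zero hh hq (MvPolynomial.funext fun v => by simpa using hcon v)
  obtain ⟨v, hv⟩ := this
  rw [map_mul, mul_ne_zero_iff] at hv
  refine ⟨v, hv.1, (eval v q)⁻¹ • W.map (eval v), ?_⟩
  have := congrArg (fun M => M.map (eval v)) hW
  simp only [Matrix.map_mul] at this
  rw [Matrix.mul_smul, this]
  ext i j
  by_cases hij : i = j <;> simp [Matrix.one_apply, hij, hv.2]

lemma eq_C_of_pderiv_eq_zero {ι : Type} {F : MvPolynomial ι ℂ}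
    (h : ∀ s, pderiv s F = 0) : F = C (F.coeff 0) := by
  classical
  ext m
  rw [coeff_C]
  split_ifs with hm
  · rw [hm]
  · obtain ⟨s, hs⟩ : ∃ s, m s ≠ 0 := by
      by_contra! hcon
      exact hm (Finsupp.ext fun s => (hcon s).symm)
    have := congrArg (coeff (m - Finsupp.single s 1)) (h s)
    rw [coeff_pderiv, tsub_add_cancel_of_le (by simpa [Nat.one_le_iff_ne_zero] using hs),
      coeff_zero] at this
    rcases mul_eq_zero.1 this with h0 | h0
    · exact h0
    · exact absurd h0 (Nat.cast_add_one_ne_zero _)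

lemma pderiv_aeval {ι τ : Type} [Fintype ι] (P : ι → MvPolynomial τ ℂ) (F : MvPolynomial ι ℂ)
    (l : τ) : pderiv l (aeval P F) = ∑ s, aeval P (pderiv s F) * pderiv l (P s) := by
  classical
  induction F using MvPolynomial.induction_on with
  | C a => simp
  | add p q hp hq => simp only [map_add, hp, hq, add_mul, Finset.sum_add_distrib]
  | mul_X p i hp =>
    simp only [map_mul, Derivation.leibniz, hp, pderiv_X, smul_eq_mul, map_add, add_mul,
      Finset.sum_add_distrib, aeval_X, Finset.mul_sum]
    congr 1
    · rw [Finset.sum_eq_single i] <;> simp +contextual [eq_comm]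
    · simp_rw [mul_assoc]

lemma algebraicIndependent_of_jacobianMatrix {ι τ : Type} [Fintype ι] [Fintype τ] [DecidableEq ι]
    (P : ι → MvPolynomial τ ℂ) (v : τ → ℂ) (W : Matrix τ ι ℂ)
    (hW : (jacobianMatrix P).map (eval v) * W = 1) : AlgebraicIndependent ℂ P := by
  rw [algebraicIndependent_iff]
  intro F
  induction hn : F.totalDegree using Nat.strong_induction_on generalizing F with
  | _ n ih =>
  intro hF
  let V : Matrix τ ι (MvPolynomial τ ℂ) := W.map C
  let J : Matrix ι ι (MvPolynomial τ ℂ) := jacobianMatrix P * V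
  have hJ : J.det ≠ 0 := by
    intro h0
    have h1 : (J.map (eval v)).det = 0 := by
      have := (RingHom.map_det (eval v) J).symm
      rw [h0, map_zero] at this
      exact this
    have h2 : J.map (eval v) = 1 := by
      simp only [J, Matrix.map_mul]
      rw [← hW]
      congr 1
      ext i j
      simp [V]
    rw [h2, Matrix.det_one] at h1
    exact one_ne_zero h1
  have hvec : (fun s => aeval P (pderiv s F)) ᵥ* jacobianMatrix P = 0 := by
    ext1 l
    have := pderiv_aeval P F l
    rw [hF, map_zero] at this
    simpa [Matrix.vecMul, dotProduct, jacobianMatrix] using this.symm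
  have hvec2 : (fun s => aeval P (pderiv s F)) ᵥ* J = 0 := by
    simp only [J]
    rw [← Matrix.vecMul_vecMul, hvec, Matrix.zero_vecMul]
  have hz := Matrix.eq_zero_of_vecMul_eq_zero hJ hvec2
  have hconst : F = C (F.coeff 0) := by
    refine eq_C_of_pderiv_eq_zero fun s => ?_
    by_contra hs
    have hlt : (pderiv s F).totalDegree < n := by
      have key : ∀ m ∈ (pderiv s F).support, (m.sum fun _ e => e) + 1 ≤ n := by
        intro m hm
        rw [mem_support_iff, coeff_pderiv] at hm
        have := le_totalDegree (mem_support_iff.2 (left_ne_zero_of_mul hm))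
        rw [Finsupp.sum_add_index' (by simp) (by simp), Finsupp.sum_single_index rfl] at this
        omega
      obtain ⟨m, hm⟩ := support_nonempty.2 hs
      have hn1 := key m hm
      have : (pderiv s F).totalDegree ≤ n - 1 :=
        Finset.sup_le fun m hm => by have := key m hm; omega
      omega
    exact hs (ih _ hlt _ rfl (congrFun hz s))
  rw [hconst] at hF ⊢
  simpa using hF

/-- A dominant polynomial map of affine spaces hits a general point, even after removing
a hypersurface from the source. -/
lemma exists_forall_eval_ne_zero_exists_of_algebraicIndependent {ι τ : Type} [Finite ι] [Finite τ]
    {P : ι → MvPolynomial τ ℂ} (hP : AlgebraicIndependent ℂ P) {h : MvPolynomial τ ℂ}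
    (hh : h ≠ 0) :
    ∃ Φ : MvPolynomial ι ℂ, Φ ≠ 0 ∧ ∀ c : ι → ℂ, eval c Φ ≠ 0 →
      ∃ v : τ → ℂ, eval v h ≠ 0 ∧ ∀ s, eval v (P s) = c s := by
  let φ : MvPolynomial ι ℂ →+* MvPolynomial τ ℂ := (aeval P).toRingHom
  have hfp : φ.FinitePresentation := by
    apply RingHom.FinitePresentation.of_comp_finiteType (f := algebraMap ℂ (MvPolynomial ι ℂ))
    · have : φ.comp (algebraMap ℂ (MvPolynomial ι ℂ)) = algebraMap ℂ (MvPolynomial τ ℂ) :=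
        (aeval P).comp_algebraMap
      rw [this, RingHom.finitePresentation_algebraMap]
      infer_instance
    · exact RingHom.finiteType_algebraMap.2 inferInstance
  have hcons : Topology.IsConstructible (PrimeSpectrum.comap φ '' (PrimeSpectrum.basicOpen h : Set _)) :=
    PrimeSpectrum.isConstructible_comap_image hfp
      (PrimeSpectrum.isConstructible_basicOpen)
  obtain ⟨S, hS⟩ := PrimeSpectrum.exists_constructibleSetData_iff.2 hcons
  have hbot : (⊥ : PrimeSpectrum (MvPolynomial ι ℂ)) ∈ S.toSet := by
    rw [hS]
    refine ⟨⊥, by simpa using hh, ?_⟩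
    ext x
    simpa [φ] using injective_iff_map_eq_zero' _ |>.1 hP x
  simp only [PrimeSpectrum.ConstructibleSetData.toSet, Set.mem_iUnion,
    PrimeSpectrum.BasicConstructibleSetData.toSet, Set.mem_sdiff,
    PrimeSpectrum.mem_zeroLocus] at hbot
  obtain ⟨D, hD, hg, hf⟩ := hbot
  have hg0 : ∀ i, D.g i = 0 := fun i => by simpa using hg ⟨i, rfl⟩
  have hf0 : D.f ≠ 0 := by simpa using hf
  refine ⟨D.f, hf0, fun c hc => ?_⟩
  have hprime : (RingHom.ker (eval c)).IsPrime := RingHom.ker_isPrime _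
  let pc : PrimeSpectrum (MvPolynomial ι ℂ) := ⟨RingHom.ker (eval c), hprime⟩
  have hpc : pc ∈ S.toSet := by
    simp only [PrimeSpectrum.ConstructibleSetData.toSet, Set.mem_iUnion,
      PrimeSpectrum.BasicConstructibleSetData.toSet, Set.mem_sdiff, PrimeSpectrum.mem_zeroLocus]
    refine ⟨D, hD, ?_, by simpa [pc, RingHom.mem_ker] using hc⟩
    rintro _ ⟨i, rfl⟩
    simp [hg0 i]
  rw [hS] at hpc
  obtain ⟨q, hq, hqc⟩ := hpc
  have hqh : h ∉ q.asIdeal := hq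
  have hrad := vanishingIdeal_zeroLocus_eq_radical (K := ℂ) q.asIdeal
  rw [q.2.radical] at hrad
  rw [← hrad, mem_vanishingIdeal_iff] at hqh
  push Not at hqh
  obtain ⟨v, hv, hvh⟩ := hqh
  refine ⟨v, by simpa [aeval_eq_eval] using hvh, fun s => ?_⟩
  have hmem : (X s - C (c s) : MvPolynomial ι ℂ) ∈ (PrimeSpectrum.comap φ q).asIdeal := by
    rw [hqc]
    simp [pc, RingHom.mem_ker]
  have hmem2 : P s - C (c s) ∈ q.asIdeal := by
    have := Ideal.mem_comap.1 hmem
    simpa [φ] using this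
  have := mem_zeroLocus_iff.1 hv _ hmem2
  simpa [sub_eq_zero, aeval_eq_eval] using this

section Forms

variable {σ T : Type} [CommRing T]

/-- `f` is zero or homogeneous of degree `m : ℤ`, over any ring of coefficients. -/
def IsForm (f : MvPolynomial σ T) (m : ℤ) : Prop :=
  ∀ s, coeff s f ≠ 0 → (s.degree : ℤ) = m

lemma isFormOfDeg_iff_isForm {k : ℕ} {f : MvPolynomial (Fin k) ℂ} {m : ℤ} :
    IsFormOfDeg f m ↔ IsForm f m := by
  unfold IsFormOfDeg IsForm
  split_ifs with hm
  · refine ⟨fun h => by simp [h], fun h => ?_⟩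
    ext s
    by_contra hs
    have := h s (by simpa using hs)
    omega
  · unfold IsHomogeneous IsWeightedHomogeneous
    refine forall_congr' fun s => forall_congr' fun _ => ?_
    have : s.degree = Finsupp.weight 1 s := DFunLike.congr_fun Finsupp.degree_eq_weight_one s
    omega

lemma isForm_natCast_iff {f : MvPolynomial σ T} {m : ℕ} : IsForm f m ↔ f.IsHomogeneous m := by
  unfold IsForm IsHomogeneous IsWeightedHomogeneous
  refine forall_congr' fun s => forall_congr' fun _ => ?_
  have : s.degree = Finsupp.weight 1 s := DFunLike.congr_fun Finsupp.degree_eq_weight_one s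
  omega

namespace IsForm

lemma zero (m : ℤ) : IsForm (0 : MvPolynomial σ T) m := fun s hs => by simp at hs

lemma add {f g : MvPolynomial σ T} {m : ℤ} (hf : IsForm f m) (hg : IsForm g m) :
    IsForm (f + g) m := by
  intro s hs
  by_cases h : coeff s f = 0
  · exact hg s (by simpa [h] using hs)
  · exact hf s h

lemma sum {ι : Type*} {I : Finset ι} {f : ι → MvPolynomial σ T} {m : ℤ}
    (hf : ∀ i ∈ I, IsForm (f i) m) : IsForm (∑ i ∈ I, f i) m :=
  Finset.sum_induction f (IsForm · m) (fun _ _ => add) (zero m) hf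

lemma mul {f g : MvPolynomial σ T} {m l : ℤ} (hf : IsForm f m) (hg : IsForm g l) :
    IsForm (f * g) (m + l) := by
  classical
  intro s hs
  rw [coeff_mul] at hs
  obtain ⟨p, hp, hne⟩ := Finset.exists_ne_zero_of_sum_ne_zero hs
  rw [← Finset.HasAntidiagonal.mem_antidiagonal.1 hp, ← hf _ (left_ne_zero_of_mul hne),
    ← hg _ (right_ne_zero_of_mul hne)]
  simp

lemma C (a : T) : IsForm (MvPolynomial.C a : MvPolynomial σ T) 0 := by
  exact_mod_cast isForm_natCast_iff.2 (isHomogeneous_C σ a)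

lemma X (i : σ) : IsForm (X i : MvPolynomial σ T) 1 := by
  exact_mod_cast isForm_natCast_iff.2 (isHomogeneous_X T i)

lemma C_mul {f : MvPolynomial σ T} {m : ℤ} (a : T) (hf : IsForm f m) :
    IsForm (MvPolynomial.C a * f) m := by
  simpa using (C a).mul hf

lemma neg {f : MvPolynomial σ T} {m : ℤ} (hf : IsForm f m) : IsForm (-f) m := by
  simpa using hf.C_mul (-1)

lemma sub {f g : MvPolynomial σ T} {m : ℤ} (hf : IsForm f m) (hg : IsForm g m) :
    IsForm (f - g) m := by
  simpa [sub_eq_add_neg] using hf.add hg.neg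

lemma smul {f : MvPolynomial σ T} {m : ℤ} (a : T) (hf : IsForm f m) : IsForm (a • f) m := by
  rw [smul_eq_C_mul]
  exact hf.C_mul a

lemma prod {ι : Type*} {I : Finset ι} {f : ι → MvPolynomial σ T} {m : ι → ℤ}
    (hf : ∀ i ∈ I, IsForm (f i) (m i)) : IsForm (∏ i ∈ I, f i) (∑ i ∈ I, m i) := by
  classical
  induction I using Finset.induction_on with
  | empty => simpa using C (1 : T)
  | insert i I hi ih =>
    rw [Finset.prod_insert hi, Finset.sum_insert hi]
    exact (hf i (by simp)).mul (ih fun j hj => hf j (by simp [hj]))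

lemma monomial {s : σ →₀ ℕ} {m : ℤ} (hs : (s.degree : ℤ) = m) (a : T) :
    IsForm (MvPolynomial.monomial s a) m := by
  classical
  intro t ht
  rw [coeff_monomial] at ht
  split_ifs at ht with h
  · rw [← h, hs]
  · exact absurd rfl ht

lemma pow {f : MvPolynomial σ T} {m : ℤ} (hf : IsForm f m) (k : ℕ) : IsForm (f ^ k) (k * m) := by
  simpa using prod (I := Finset.range k) (f := fun _ => f) fun _ _ => hf

lemma map {T' : Type} [CommRing T'] (φ : T →+* T') {f : MvPolynomial σ T} {m : ℤ}
    (hf : IsForm f m) : IsForm (MvPolynomial.map φ f) m := by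
  intro s hs
  refine hf s fun h => hs ?_
  rw [coeff_map, h, map_zero]

lemma aeval {σ' : Type} {g : σ → MvPolynomial σ' T} (hg : ∀ i, IsForm (g i) 1)
    {f : MvPolynomial σ T} {m : ℤ} (hf : IsForm f m) : IsForm (MvPolynomial.aeval g f) m := by
  rw [aeval_def, eval₂_eq]
  refine sum fun s hs => ?_
  have h1 := prod (I := s.support) (f := fun i => g i ^ s i) (m := fun i => (s i : ℤ) * 1)
    fun i _ => (hg i).pow (s i)
  have h2 : ∑ i ∈ s.support, (s i : ℤ) * 1 = m := by
    rw [← hf s (by simpa using hs)]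
    simp [Finsupp.degree_apply]
  rw [h2] at h1
  exact h1.C_mul _

end IsForm

/-- The homogeneous component of degree `m : ℤ`. -/
noncomputable def formPart (m : ℤ) : MvPolynomial σ T →ₗ[T] MvPolynomial σ T :=
  if m < 0 then 0 else homogeneousComponent m.toNat

lemma coeff_formPart (m : ℤ) (f : MvPolynomial σ T) (s : σ →₀ ℕ) :
    coeff s (formPart m f) = if (s.degree : ℤ) = m then coeff s f else 0 := by
  unfold formPart
  split_ifs with h1 h2 h2
  · omega
  · simp
  · rw [coeff_homogeneousComponent, if_pos (by omega)]
  · rw [coeff_homogeneousComponent, if_neg (by omega)]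

lemma isForm_formPart (m : ℤ) (f : MvPolynomial σ T) : IsForm (formPart m f) m := by
  intro s hs
  rw [coeff_formPart] at hs
  split_ifs at hs with h
  · exact h
  · exact absurd rfl hs

lemma IsForm.formPart_eq {f : MvPolynomial σ T} {m : ℤ} (hf : IsForm f m) : formPart m f = f := by
  ext s
  rw [coeff_formPart]
  split_ifs with h
  · rfl
  · by_contra h0
    exact h (hf s (Ne.symm h0))

lemma formPart_mul (d e : ℤ) (f : MvPolynomial σ T) {g : MvPolynomial σ T} (hg : IsForm g e) :
    formPart d (f * g) = formPart (d - e) f * g := by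
  classical
  ext s
  rw [coeff_formPart, coeff_mul, coeff_mul]
  simp only [coeff_formPart, ite_mul, zero_mul]
  trans ∑ p ∈ Finset.HasAntidiagonal.antidiagonal s,
    if (s.degree : ℤ) = d then coeff p.1 f * coeff p.2 g else 0
  · split_ifs <;> simp
  refine Finset.sum_congr rfl fun p hp => ?_
  by_cases h0 : coeff p.2 g = 0
  · simp [h0]
  have h1 := hg _ h0
  have h2 : s.degree = p.1.degree + p.2.degree := by
    rw [← Finset.HasAntidiagonal.mem_antidiagonal.1 hp]; simp
  congr 1
  rw [h2, eq_iff_iff]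
  push_cast
  omega

lemma exists_isForm_sum_mul_eq {κ : Type*} [Fintype κ] {M : κ → MvPolynomial σ T} {e : κ → ℤ}
    (hM : ∀ j, IsForm (M j) (e j)) {F : MvPolynomial σ T} {d : ℤ} (hF : IsForm F d)
    {c : κ → MvPolynomial σ T} (hc : F = ∑ j, c j * M j) :
    ∃ g : κ → MvPolynomial σ T, (∀ j, IsForm (g j) (d - e j)) ∧ F = ∑ j, g j * M j := by
  refine ⟨fun j => formPart (d - e j) (c j), fun j => isForm_formPart _ _, ?_⟩
  have := congrArg (formPart d) hc
  rw [hF.formPart_eq, map_sum] at this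
  rw [this]
  exact Finset.sum_congr rfl fun j _ => formPart_mul _ _ _ (hM j)

end Forms

section SignedMinors

variable {R : Type} [CommRing R] {n : ℕ}

/-- The maximal minor omitting column `j`, with its Laplace sign. -/
def signedMinor (A : Matrix (Fin n) (Fin (n + 1)) R) (j : Fin (n + 1)) : R :=
  (-1) ^ (j : ℕ) * (A.submatrix id j.succAbove).det

lemma map_signedMinor {R' : Type} [CommRing R'] (φ : R →+* R')
    (A : Matrix (Fin n) (Fin (n + 1)) R) (j : Fin (n + 1)) :
    φ (signedMinor A j) = signedMinor (A.map φ) j := by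
  simp [signedMinor, RingHom.map_det, Matrix.submatrix_map]

/-- The square matrix with first row `c` followed by the rows of `A`. -/
def consRow (c : Fin (n + 1) → R) (A : Matrix (Fin n) (Fin (n + 1)) R) :
    Matrix (Fin (n + 1)) (Fin (n + 1)) R :=
  Matrix.of (Fin.cons c A)

lemma det_consRow (c : Fin (n + 1) → R) (A : Matrix (Fin n) (Fin (n + 1)) R) :
    (consRow c A).det = ∑ j, c j * signedMinor A j := by
  rw [det_succ_row_zero]
  refine Finset.sum_congr rfl fun j _ => ?_
  have : (consRow c A).submatrix Fin.succ j.succAbove = A.submatrix id j.succAbove := rfl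
  rw [this, signedMinor]
  have h0 : consRow c A 0 j = c j := rfl
  rw [h0]
  ring

lemma sum_mul_signedMinor (A : Matrix (Fin n) (Fin (n + 1)) R) (i : Fin n) :
    ∑ j, A i j * signedMinor A j = 0 := by
  rw [← det_consRow]
  exact det_zero_of_row_eq (Fin.succ_ne_zero i).symm rfl

lemma sum_vecMul_mul_signedMinor (A : Matrix (Fin n) (Fin (n + 1)) R) (u : Fin n → R) :
    ∑ j, (u ᵥ* A) j * signedMinor A j = 0 := by
  simp only [vecMul, dotProduct, Finset.sum_mul]
  rw [Finset.sum_comm]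
  refine Finset.sum_eq_zero fun i _ => ?_
  simp_rw [mul_assoc]
  rw [← Finset.mul_sum, sum_mul_signedMinor, mul_zero]

lemma adjugate_consRow_zero (c : Fin (n + 1) → R) (A : Matrix (Fin n) (Fin (n + 1)) R)
    (j : Fin (n + 1)) : (consRow c A).adjugate j 0 = signedMinor A j := by
  rw [adjugate_fin_succ_eq_det_submatrix]
  have : (consRow c A).submatrix (Fin.succAbove 0) j.succAbove = A.submatrix id j.succAbove := by
    ext; rfl
  rw [this, signedMinor]
  simp

lemma exists_vecMul_eq_signedMinor_smul (A : Matrix (Fin n) (Fin (n + 1)) R)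
    {c : Fin (n + 1) → R} (hc : ∑ j, c j * signedMinor A j = 0) (j : Fin (n + 1)) :
    ∃ u, u ᵥ* A = signedMinor A j • c := by
  have h : (consRow c A).adjugate * consRow c A = 0 := by
    rw [adjugate_mul, det_consRow, hc, zero_smul]
  refine ⟨fun i => -(consRow c A).adjugate j i.succ, ?_⟩
  ext l
  have := congrFun (congrFun h j) l
  rw [mul_apply, Fin.sum_univ_succ, adjugate_consRow_zero] at this
  have h0 : consRow c A 0 l = c l := rfl
  have h1 : ∀ i : Fin n, consRow c A i.succ l = A i l := fun _ => rfl
  simp only [h0, h1, Matrix.zero_apply] at this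
  simp only [vecMul, dotProduct, neg_mul, Finset.sum_neg_distrib, Pi.smul_apply, smul_eq_mul]
  exact (eq_neg_of_add_eq_zero_left this).symm

/-- The ideal of maximal minors, over any commutative ring. -/
def signedMinorsIdeal (A : Matrix (Fin n) (Fin (n + 1)) R) : Ideal R :=
  Ideal.span (Set.range (signedMinor A))

lemma mem_signedMinorsIdeal {A : Matrix (Fin n) (Fin (n + 1)) R} {f : R} :
    f ∈ signedMinorsIdeal A ↔ ∃ c : Fin (n + 1) → R, ∑ j, c j * signedMinor A j = f := by
  simp [signedMinorsIdeal, Ideal.mem_span_range_iff_exists_fun]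

lemma signedMinor_mem (A : Matrix (Fin n) (Fin (n + 1)) R) (j : Fin (n + 1)) :
    signedMinor A j ∈ signedMinorsIdeal A :=
  Ideal.subset_span ⟨j, rfl⟩

lemma exists_vecMul_eq_smul (A : Matrix (Fin n) (Fin (n + 1)) R)
    {c : Fin (n + 1) → R} (hc : ∑ j, c j * signedMinor A j = 0) {f : R}
    (hf : f ∈ signedMinorsIdeal A) : ∃ u, u ᵥ* A = f • c := by
  obtain ⟨r, rfl⟩ := mem_signedMinorsIdeal.1 hf
  choose u hu using exists_vecMul_eq_signedMinor_smul A hc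
  refine ⟨∑ j, r j • u j, ?_⟩
  rw [Matrix.sum_vecMul, Finset.sum_smul]
  refine Finset.sum_congr rfl fun j _ => ?_
  rw [Matrix.smul_vecMul, hu, smul_smul]

variable [IsDomain R]

lemma eq_zero_of_vecMul_eq_zero_of_signedMinor_ne_zero {A : Matrix (Fin n) (Fin (n + 1)) R}
    {j : Fin (n + 1)} (hj : signedMinor A j ≠ 0) {w : Fin n → R} (hw : w ᵥ* A = 0) : w = 0 := by
  refine eq_zero_of_vecMul_eq_zero (M := A.submatrix id j.succAbove) (right_ne_zero_of_mul hj) ?_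
  ext l
  exact congrFun hw (j.succAbove l)

lemma eq_zero_of_vecMul_eq_zero_of_mem {A : Matrix (Fin n) (Fin (n + 1)) R} {p : R} (hp : p ≠ 0)
    (hpA : p ∈ signedMinorsIdeal A) {w : Fin n → R} (hw : w ᵥ* A = 0) : w = 0 := by
  by_contra hne
  obtain ⟨r, hr⟩ := mem_signedMinorsIdeal.1 hpA
  apply hp
  rw [← hr]
  refine Finset.sum_eq_zero fun j _ => ?_
  by_cases hj : signedMinor A j = 0
  · rw [hj, mul_zero]
  · exact absurd (eq_zero_of_vecMul_eq_zero_of_signedMinor_ne_zero hj hw) hne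

/-- Hilbert–Burch: if the ideal of maximal minors contains two relatively prime elements then
every syzygy of the signed minors is a combination of the rows. -/
lemma exists_eq_vecMul_of_sum_mul_signedMinor_eq_zero {A : Matrix (Fin n) (Fin (n + 1)) R}
    {p q : R} (hp : p ∈ signedMinorsIdeal A) (hq : q ∈ signedMinorsIdeal A) (hp0 : p ≠ 0)
    (hpq : ∀ r, p ∣ q * r → p ∣ r) {c : Fin (n + 1) → R}
    (hc : ∑ j, c j * signedMinor A j = 0) : ∃ w, c = w ᵥ* A := by
  obtain ⟨u, hu⟩ := exists_vecMul_eq_smul A hc hp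
  obtain ⟨u', hu'⟩ := exists_vecMul_eq_smul A hc hq
  have h0 : q • u - p • u' = 0 := by
    apply eq_zero_of_vecMul_eq_zero_of_mem hp0 hp
    rw [Matrix.sub_vecMul, Matrix.smul_vecMul, Matrix.smul_vecMul, hu, hu', smul_comm, sub_self]
  have hdvd : ∀ i, p ∣ u i := fun i =>
    hpq _ ⟨u' i, by simpa [sub_eq_zero] using congrFun h0 i⟩
  choose w hw using hdvd
  refine ⟨w, ?_⟩
  have huw : u = p • w := funext fun i => hw i
  rw [huw, Matrix.smul_vecMul] at hu
  exact (smul_right_injective _ hp0 hu).symm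

end SignedMinors

lemma signedMinorsIdeal_eq_minorsIdeal {k n : ℕ}
    (A : Matrix (Fin n) (Fin (n + 1)) (MvPolynomial (Fin k) ℂ)) :
    signedMinorsIdeal A = minorsIdeal A := by
  unfold signedMinorsIdeal minorsIdeal
  apply le_antisymm <;> rw [Ideal.span_le] <;> rintro _ ⟨j, rfl⟩
  · exact Ideal.mul_mem_left _ _ (Ideal.subset_span ⟨j, rfl⟩)
  · have : (A.submatrix id j.succAbove).det = (-1) ^ (j : ℕ) * signedMinor A j := by
      rw [signedMinor, ← mul_assoc, ← mul_pow]
      simp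
    simp only [this]
    exact Ideal.mul_mem_left _ _ (Ideal.subset_span ⟨j, rfl⟩)

/-- Degrees `b i`, `a j` of the syzygies and of the generators attached to a degree matrix. -/
lemma exists_degrees_of_isHomogMatrix {n : ℕ} {Q : Matrix (Fin n) (Fin (n + 1)) ℤ}
    (hQ : IsHomogMatrix Q) :
    ∃ (b : Fin n → ℤ) (a : Fin (n + 1) → ℤ), (∀ i j, Q i j = b i - a j) ∧ ∑ i, b i = ∑ j, a j := by
  have h1 : ∃ (b : Fin n → ℤ) (a : Fin (n + 1) → ℤ), ∀ i j, Q i j = b i - a j := by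
    rcases n with _ | n
    · exact ⟨0, 0, fun i => i.elim0⟩
    · refine ⟨fun i => Q i 0, fun j => Q 0 0 - Q 0 j, fun i j => ?_⟩
      rcases eq_or_ne i 0 with rfl | hi
      · ring
      rcases eq_or_ne j 0 with rfl | hj
      · ring
      have := hQ 0 i 0 j (Fin.pos_iff_ne_zero.2 hi) (Fin.pos_iff_ne_zero.2 hj)
      linarith
  obtain ⟨b, a, h⟩ := h1
  refine ⟨fun i => b i + (∑ i, b i - ∑ j, a j), fun j => a j + (∑ i, b i - ∑ j, a j),
    fun i j => by rw [h]; ring, ?_⟩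
  simp [Finset.sum_add_distrib]
  ring

lemma isForm_signedMinor {σ T : Type} [CommRing T] {n : ℕ} {b : Fin n → ℤ} {a : Fin (n + 1) → ℤ}
    (hab : ∑ i, b i = ∑ j, a j) {A : Matrix (Fin n) (Fin (n + 1)) (MvPolynomial σ T)}
    (hA : ∀ i j, IsForm (A i j) (b i - a j)) (j : Fin (n + 1)) :
    IsForm (signedMinor A j) (a j) := by
  rw [signedMinor, det_apply, Finset.mul_sum]
  refine IsForm.sum fun τ _ => ?_
  have h := IsForm.prod (I := Finset.univ) fun i _ => hA (τ i) (j.succAbove i)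
  have hdeg : ∑ i, (b (τ i) - a (j.succAbove i)) = a j := by
    rw [Finset.sum_sub_distrib, Equiv.sum_comp τ b, hab, Fin.sum_univ_succAbove a j]
    ring
  rw [hdeg] at h
  have h1 : (-1 : MvPolynomial σ T) ^ (j : ℕ) = C ((-1) ^ (j : ℕ)) := by simp
  rw [h1]
  refine IsForm.C_mul _ ?_
  rw [Units.smul_def, ← Int.cast_smul_eq_zsmul T]
  exact h.smul _

/-- A linear form with leading variable `X 0`. -/
noncomputable def lineForm (p : Fin 2 → ℂ) : MvPolynomial (Fin 3) ℂ :=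
  X 0 - C (p 0) * X 1 - C (p 1) * X 2

/-- Restriction of polynomials to the line `lineForm p = 0`. -/
noncomputable def restrictLine (p : Fin 2 → ℂ) :
    MvPolynomial (Fin 3) ℂ →ₐ[ℂ] MvPolynomial (Fin 2) ℂ :=
  aeval ![C (p 0) * X 0 + C (p 1) * X 1, X 0, X 1]

lemma restrictLine_rename (p : Fin 2 → ℂ) (f : MvPolynomial (Fin 2) ℂ) :
    restrictLine p (rename Fin.succ f) = f := by
  rw [restrictLine, aeval_rename]
  convert aeval_X_left_apply f
  ext i
  fin_cases i <;> rfl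

lemma restrictLine_lineForm (p : Fin 2 → ℂ) : restrictLine p (lineForm p) = 0 := by
  simp [restrictLine, lineForm]

lemma lineForm_dvd_sub_rename_restrictLine (p : Fin 2 → ℂ) (f : MvPolynomial (Fin 3) ℂ) :
    lineForm p ∣ f - rename Fin.succ (restrictLine p f) := by
  have h : (Ideal.Quotient.mkₐ ℂ (Ideal.span {lineForm p})).comp
      ((rename Fin.succ).comp (restrictLine p)) = Ideal.Quotient.mkₐ ℂ (Ideal.span {lineForm p}) := by
    refine MvPolynomial.algHom_ext fun i => ?_
    simp only [AlgHom.comp_apply, Ideal.Quotient.mkₐ_eq_mk]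
    rw [eq_comm, Ideal.Quotient.eq, Ideal.mem_span_singleton]
    fin_cases i
    · refine ⟨1, ?_⟩
      simp [restrictLine, lineForm]
      ring
    · simp [restrictLine]
    · simp [restrictLine]
  have := DFunLike.congr_fun h f
  simp only [AlgHom.comp_apply, Ideal.Quotient.mkₐ_eq_mk] at this
  rwa [eq_comm, Ideal.Quotient.eq, Ideal.mem_span_singleton] at this

lemma lineForm_dvd_of_restrictLine_eq_zero {p : Fin 2 → ℂ} {f : MvPolynomial (Fin 3) ℂ}
    (hf : restrictLine p f = 0) : lineForm p ∣ f := by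
  simpa [hf] using lineForm_dvd_sub_rename_restrictLine p f

lemma lineForm_ne_zero (p : Fin 2 → ℂ) : lineForm p ≠ 0 := by
  intro h
  have := congrArg (eval ![1, 0, 0]) h
  simp [lineForm] at this

lemma isForm_lineForm (p : Fin 2 → ℂ) : IsForm (lineForm p) 1 :=
  ((IsForm.X 0).sub ((IsForm.X 1).C_mul _)).sub ((IsForm.X 2).C_mul _)

lemma isForm_restrictLine (p : Fin 2 → ℂ) {f : MvPolynomial (Fin 3) ℂ} {m : ℤ}
    (hf : IsForm f m) : IsForm (restrictLine p f) m := by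
  refine hf.aeval fun i => ?_
  fin_cases i
  · exact ((IsForm.X 0).C_mul _).add ((IsForm.X 1).C_mul _)
  · exact IsForm.X 0
  · exact IsForm.X 1

lemma X_zero_pow_dvd_of_dvd_mul (k : ℕ) (r : MvPolynomial (Fin 2) ℂ)
    (h : X 0 ^ k ∣ X 1 ^ k * r) : (X 0 ^ k : MvPolynomial (Fin 2) ℂ) ∣ r := by
  have hp : Prime (X 0 : MvPolynomial (Fin 2) ℂ) := X_prime
  refine hp.pow_dvd_of_dvd_mul_left k ?_ h
  rintro ⟨g, hg⟩
  have := congrArg (eval ![0, 1]) hg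
  simp at this

/-- Every monomial of degree `k` vanishes modulo `I` and `L`. -/
def IsGoodLine (L : MvPolynomial (Fin 3) ℂ) (k : ℕ) (I : Ideal (MvPolynomial (Fin 3) ℂ)) : Prop :=
  ∀ s : Fin 3 →₀ ℕ, s.degree = k → monomial s 1 ∈ I ⊔ Ideal.span {L}

section

variable {n k : ℕ} {p : Fin 2 → ℂ} {A : Matrix (Fin n) (Fin (n + 1)) (MvPolynomial (Fin 3) ℂ)}

lemma restrictLine_mem_of_mem_sup {f : MvPolynomial (Fin 3) ℂ}
    (hf : f ∈ signedMinorsIdeal A ⊔ Ideal.span {lineForm p}) :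
    restrictLine p f ∈ signedMinorsIdeal (A.map (restrictLine p)) := by
  obtain ⟨g, hg, l, hl, rfl⟩ := Submodule.mem_sup.1 hf
  obtain ⟨q, rfl⟩ := Ideal.mem_span_singleton.1 hl
  obtain ⟨c, rfl⟩ := mem_signedMinorsIdeal.1 hg
  rw [map_add, map_mul, restrictLine_lineForm, zero_mul, add_zero]
  refine mem_signedMinorsIdeal.2 ⟨fun j => restrictLine p (c j), ?_⟩
  rw [map_sum]
  refine Finset.sum_congr rfl fun j _ => ?_
  rw [map_mul]
  congr 1
  exact (map_signedMinor (restrictLine p).toRingHom A j).symm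

lemma IsGoodLine.X_pow_mem (h : IsGoodLine (lineForm p) k (signedMinorsIdeal A)) (i : Fin 2) :
    X i ^ k ∈ signedMinorsIdeal (A.map (restrictLine p)) := by
  have := restrictLine_mem_of_mem_sup (h (Finsupp.single i.succ k) (by simp))
  rw [← X_pow_eq_monomial, map_pow, ← rename_X Fin.succ i, restrictLine_rename] at this
  exact this

lemma IsGoodLine.exists_eq_vecMul (h : IsGoodLine (lineForm p) k (signedMinorsIdeal A))
    {c : Fin (n + 1) → MvPolynomial (Fin 2) ℂ}
    (hc : ∑ j, c j * signedMinor (A.map (restrictLine p)) j = 0) :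
    ∃ w, c = w ᵥ* A.map (restrictLine p) :=
  exists_eq_vecMul_of_sum_mul_signedMinor_eq_zero (h.X_pow_mem 0) (h.X_pow_mem 1)
    (pow_ne_zero _ (X_ne_zero _)) (X_zero_pow_dvd_of_dvd_mul k) hc

lemma IsGoodLine.mem_of_lineForm_mul_mem (h : IsGoodLine (lineForm p) k (signedMinorsIdeal A))
    {f : MvPolynomial (Fin 3) ℂ} (hf : lineForm p * f ∈ signedMinorsIdeal A) :
    f ∈ signedMinorsIdeal A := by
  obtain ⟨c, hc⟩ := mem_signedMinorsIdeal.1 hf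
  have h1 : ∑ j, restrictLine p (c j) * signedMinor (A.map (restrictLine p)) j = 0 := by
    have := congrArg (restrictLine p) hc
    rw [map_mul, restrictLine_lineForm, zero_mul, map_sum] at this
    rw [← this]
    refine Finset.sum_congr rfl fun j _ => ?_
    rw [map_mul]
    congr 1
    exact (map_signedMinor (restrictLine p).toRingHom A j).symm
  obtain ⟨w, hw⟩ := h.exists_eq_vecMul h1
  have h2 : ∀ j, lineForm p ∣ c j - ((fun i => rename Fin.succ (w i)) ᵥ* A) j := by
    intro j
    apply lineForm_dvd_of_restrictLine_eq_zero
    rw [map_sub, congrFun hw j]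
    simp [vecMul, dotProduct, restrictLine_rename]
  choose c' hc' using h2
  refine mem_signedMinorsIdeal.2 ⟨c', mul_left_cancel₀ (lineForm_ne_zero p) ?_⟩
  rw [← hc, Finset.mul_sum, ← sub_zero (∑ j, c j * _),
    ← sum_vecMul_mul_signedMinor A (fun i => rename Fin.succ (w i)), ← Finset.sum_sub_distrib]
  refine Finset.sum_congr rfl fun j _ => ?_
  rw [← sub_mul, hc', mul_assoc]

end

/-- An ideal containing all homogeneous components of its elements. -/
def IsGradedIdeal (I : Ideal (MvPolynomial (Fin 3) ℂ)) : Prop :=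
  ∀ f ∈ I, ∀ m : ℤ, formPart m f ∈ I

lemma isGradedIdeal_signedMinorsIdeal {n : ℕ}
    {A : Matrix (Fin n) (Fin (n + 1)) (MvPolynomial (Fin 3) ℂ)} {a : Fin (n + 1) → ℤ}
    (h : ∀ j, IsForm (signedMinor A j) (a j)) : IsGradedIdeal (signedMinorsIdeal A) := by
  intro f hf m
  obtain ⟨c, rfl⟩ := mem_signedMinorsIdeal.1 hf
  rw [map_sum]
  refine sum_mem fun j _ => ?_
  rw [formPart_mul m (a j) _ (h j)]
  exact Ideal.mul_mem_left _ _ (signedMinor_mem A j)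

lemma exists_degree_add_single_eq {s : Fin 3 →₀ ℕ} {k : ℕ} (hs : s.degree = k + 1) :
    ∃ (t : Fin 3 →₀ ℕ) (i : Fin 3), t.degree = k ∧ s = t + Finsupp.single i 1 := by
  obtain ⟨i, hi⟩ : ∃ i, s i ≠ 0 := by
    by_contra! h
    have : s = 0 := Finsupp.ext h
    simp [this] at hs
  have h1 : s = (s - Finsupp.single i 1) + Finsupp.single i 1 :=
    (tsub_add_cancel_of_le (by simpa [Nat.one_le_iff_ne_zero] using hi)).symm
  refine ⟨s - Finsupp.single i 1, i, ?_, h1⟩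
  have h2 := congrArg Finsupp.degree h1
  rw [map_add, Finsupp.degree_single, hs] at h2
  omega

section

variable {L : MvPolynomial (Fin 3) ℂ} {k : ℕ} {I : Ideal (MvPolynomial (Fin 3) ℂ)}

lemma IsGoodLine.monomial_mem (h : IsGoodLine L k I) (t : ℕ) {s : Fin 3 →₀ ℕ}
    (hs : s.degree = k + t) : monomial s 1 ∈ I ⊔ Ideal.span {L} := by
  induction t generalizing s with
  | zero => exact h s hs
  | succ t ih =>
    obtain ⟨u, i, hu, rfl⟩ := exists_degree_add_single_eq hs
    have : (monomial (u + Finsupp.single i 1) 1 : MvPolynomial (Fin 3) ℂ) =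
        monomial u 1 * X i := by simp [X, monomial_mul]
    rw [this]
    exact Ideal.mul_mem_right _ _ (ih hu)

lemma mem_sup_span_singleton_form (hI : IsGradedIdeal I) (hL : IsForm L 1)
    {f : MvPolynomial (Fin 3) ℂ} {m : ℤ} (hf : IsForm f m) (h : f ∈ I ⊔ Ideal.span {L}) :
    ∃ g ∈ I, ∃ q, IsForm g m ∧ IsForm q (m - 1) ∧ f = g + L * q := by
  obtain ⟨g, hg, l, hl, rfl⟩ := Submodule.mem_sup.1 h
  obtain ⟨q, rfl⟩ := Ideal.mem_span_singleton.1 hl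
  refine ⟨formPart m g, hI g hg m, formPart (m - 1) q, isForm_formPart _ _, isForm_formPart _ _, ?_⟩
  rw [mul_comm L, mul_comm L, ← formPart_mul _ _ _ hL, ← map_add, mul_comm q, hf.formPart_eq]

lemma sup_span_singleton_ne_top (hI : IsGradedIdeal I) (hL : IsForm L 1) (hne : I ≠ ⊤) :
    I ⊔ Ideal.span {L} ≠ ⊤ := by
  intro h
  have h0 : IsForm (1 : MvPolynomial (Fin 3) ℂ) 0 := by simpa using IsForm.C (σ := Fin 3) (1 : ℂ)
  obtain ⟨g, hg, q, -, hq, h1⟩ := mem_sup_span_singleton_form (f := 1) hI hL h0 (by simp [h])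
  have hq0 : q = 0 := by
    ext s
    by_contra hs
    have := hq s (by simpa using hs)
    omega
  rw [hq0, mul_zero, add_zero] at h1
  exact hne ((Ideal.eq_top_iff_one I).2 (h1 ▸ hg))

theorem IsGoodLine.isZeroDimIdeal (h : IsGoodLine L k I) (hI : IsGradedIdeal I)
    (hL : IsForm L 1) (hne : I ≠ ⊤) (hreg : ∀ f, L * f ∈ I → f ∈ I) : IsZeroDimIdeal I := by
  unfold IsZeroDimIdeal
  let B := MvPolynomial (Fin 3) ℂ ⧸ I
  let π : MvPolynomial (Fin 3) ℂ →ₐ[ℂ] B := Ideal.Quotient.mkₐ ℂ I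
  have hπ : Function.Surjective π := Ideal.Quotient.mk_surjective
  apply le_antisymm
  · let _ : Algebra (Polynomial ℂ) B := (Polynomial.aeval (π L)).toRingHom.toAlgebra
    have hX : ∀ b : B, (Polynomial.X : Polynomial ℂ) • b = π L * b := fun b => by
      rw [Algebra.smul_def]
      congr 1
      exact Polynomial.aeval_X _
    have hC : ∀ (z : ℂ) (b : B), (Polynomial.C z : Polynomial ℂ) • b = z • b := fun z b => by
      rw [Algebra.smul_def]
      refine Eq.trans ?_ (Algebra.smul_def (A := B) z b).symm
      congr 1
      exact Polynomial.aeval_C _ _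
    let M : Submodule (Polynomial ℂ) B := Submodule.span _
      ((fun s => π (monomial s 1)) '' {s : Fin 3 →₀ ℕ | s.degree ≤ k})
    have hmon : ∀ t : ℕ, ∀ s : Fin 3 →₀ ℕ, s.degree = t → π (monomial s 1) ∈ M := by
      intro t
      induction t using Nat.strong_induction_on with
      | _ t ih =>
      intro s hs
      by_cases htk : t ≤ k
      · exact Submodule.subset_span ⟨s, by simpa [hs] using htk, rfl⟩
      have hmem : monomial s 1 ∈ I ⊔ Ideal.span {L} :=
        h.monomial_mem (t - k) (by omega)
      obtain ⟨g, hg, q, -, hq, heq⟩ := mem_sup_span_singleton_form (m := t) hI hL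
        (IsForm.monomial (by exact_mod_cast hs) 1) hmem
      have hπg : π g = 0 := Ideal.Quotient.eq_zero_iff_mem.2 hg
      rw [heq, map_add, hπg, zero_add, map_mul, ← hX]
      refine M.smul_mem _ ?_
      rw [q.as_sum, map_sum]
      refine sum_mem fun u hu => ?_
      have hdeg := hq u (mem_support_iff.1 hu)
      rw [← mul_one (coeff u q), ← smul_eq_mul, ← smul_monomial, map_smul, ← hC]
      exact M.smul_mem _ (ih u.degree (by omega) u rfl)
    have htop : M = ⊤ := by
      rw [eq_top_iff]
      rintro b -
      obtain ⟨f, rfl⟩ := hπ b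
      rw [f.as_sum, map_sum]
      refine sum_mem fun u _ => ?_
      rw [← mul_one (coeff u f), ← smul_eq_mul, ← smul_monomial, map_smul, ← hC]
      exact M.smul_mem _ (hmon _ u rfl)
    have hfin : Module.Finite (Polynomial ℂ) B :=
      ⟨htop ▸ Submodule.fg_span ((Finsupp.finite_of_degree_le k).image _)⟩
    have hint : Algebra.IsIntegral (Polynomial ℂ) B := inferInstance
    have h1 : ringKrullDim (Polynomial ℂ) = 1 := by
      rw [Polynomial.ringKrullDim_of_isNoetherianRing, ringKrullDim_eq_zero_of_field, zero_add]
    rw [← h1]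
    refine Order.krullDim_le_of_strictMono
      (PrimeSpectrum.comap (algebraMap (Polynomial ℂ) B)) fun P P' hPP' => ?_
    exact Ideal.IsIntegral.comap_lt_comap hPP'
  · have hL0 : π L ∈ nonZeroDivisors B := by
      rw [mem_nonZeroDivisors_iff_right]
      intro b hb
      obtain ⟨f, rfl⟩ := hπ b
      rw [mul_comm, ← map_mul] at hb
      exact Ideal.Quotient.eq_zero_iff_mem.2 (hreg f (Ideal.Quotient.eq_zero_iff_mem.1 hb))
    have h1 := ringKrullDim_quotient_succ_le_of_nonZeroDivisor hL0
    have hnt : Nontrivial (B ⧸ Ideal.span {π L}) := by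
      rw [Ideal.Quotient.nontrivial_iff]
      intro htop
      apply sup_span_singleton_ne_top hI hL hne
      have h2 : (Ideal.span {L}).map π = ⊤ := by rw [Ideal.map_span, Set.image_singleton, htop]
      have h3 := congrArg (Ideal.comap π) h2
      rw [Ideal.comap_map_of_surjective' π hπ, Ideal.comap_top] at h3
      rw [sup_comm, ← h3]
      congr 1
      exact (Ideal.mk_ker (I := I)).symm
    have h2 : 0 ≤ ringKrullDim (B ⧸ Ideal.span {π L}) := ringKrullDim_nonneg_of_nontrivial
    calc (1 : WithBot ℕ∞) = 0 + 1 := by norm_num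
      _ ≤ ringKrullDim (B ⧸ Ideal.span {π L}) + 1 := by gcongr
      _ ≤ _ := h1

end

lemma IsZeroDimIdeal.ne_top {I : Ideal (MvPolynomial (Fin 3) ℂ)} (h : IsZeroDimIdeal I) :
    I ≠ ⊤ := by
  rintro rfl
  unfold IsZeroDimIdeal at h
  have : Subsingleton (MvPolynomial (Fin 3) ℂ ⧸ (⊤ : Ideal (MvPolynomial (Fin 3) ℂ))) :=
    Ideal.Quotient.subsingleton_iff.2 rfl
  rw [ringKrullDim_eq_bot_of_subsingleton] at h
  exact absurd h (by decide)

lemma exists_lineForm_notMem {s : Set (Ideal (MvPolynomial (Fin 3) ℂ))} (hs : s.Finite)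
    (h : ∀ q ∈ s, ∃ i, X i ∉ q) : ∃ p : Fin 2 → ℂ, ∀ q ∈ s, lineForm p ∉ q := by
  have := hs.to_subtype
  let φ : (Fin 3 → ℂ) →ₗ[ℂ] MvPolynomial (Fin 3) ℂ := Fintype.linearCombination ℂ X
  have hφ : ∀ i, φ (Pi.single i 1) = X i := fun i => by
    simp [φ, Fintype.linearCombination_apply_single]
  let V : Option s → Subspace ℂ (Fin 3 → ℂ) := fun o =>
    o.elim (LinearMap.ker (LinearMap.proj 0)) fun q => (q.1.restrictScalars ℂ).comap φ
  have hV : ∀ o, V o ≠ ⊤ := by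
    rintro (_ | q) ho
    · have h1 : (Pi.single 0 1 : Fin 3 → ℂ) ∈ V none := ho ▸ Submodule.mem_top
      simp [V] at h1
    · obtain ⟨i, hi⟩ := h q.1 q.2
      have h1 : (Pi.single i 1 : Fin 3 → ℂ) ∈ V (some q) := ho ▸ Submodule.mem_top
      exact hi (hφ i ▸ h1)
  obtain ⟨c, hc⟩ : ∃ c, c ∉ ⋃ o, (V o : Set (Fin 3 → ℂ)) := by
    by_contra! hall
    obtain ⟨o, ho⟩ := Subspace.exists_eq_top_of_iUnion_eq_univ (Set.eq_univ_of_forall hall)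
    exact hV o ho
  simp only [Set.mem_iUnion, not_exists] at hc
  have hc0 : c 0 ≠ 0 := hc none
  refine ⟨![-(c 1 / c 0), -(c 2 / c 0)], fun q hq hmem => hc (some ⟨q, hq⟩) ?_⟩
  change φ c ∈ q
  have : φ c = C (c 0) * lineForm ![-(c 1 / c 0), -(c 2 / c 0)] := by
    simp only [φ, Fintype.linearCombination_apply, Fin.sum_univ_three, lineForm, smul_eq_C_mul,
      mul_sub, cons_val_zero, cons_val_one, ← mul_assoc, map_neg]
    rw [mul_neg, mul_neg, ← C_mul, ← C_mul, mul_div_cancel₀ _ hc0, mul_div_cancel₀ _ hc0]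
    ring
  rw [this]
  exact q.mul_mem_left _ hmem

lemma homogeneousComponent_eq_formPart (f : MvPolynomial (Fin 3) ℂ) (t : ℕ) :
    homogeneousComponent t f = formPart t f := by
  ext s
  rw [coeff_homogeneousComponent, coeff_formPart]
  simp

lemma exists_isPrime_graded_le {I P : Ideal (MvPolynomial (Fin 3) ℂ)} (hI : IsGradedIdeal I)
    [hP : P.IsPrime] (hIP : I ≤ P) : ∃ c : Ideal (MvPolynomial (Fin 3) ℂ), c.IsPrime ∧ I ≤ c ∧
      c ≤ P ∧ c ≤ RingHom.ker (constantCoeff (R := ℂ) (σ := Fin 3)) ∧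
      ∀ f t, IsHomogeneous f t → f ∈ P → f ∈ c := by
  let _ : GradedAlgebra (homogeneousSubmodule (Fin 3) ℂ) := MvPolynomial.gradedAlgebra
  let c := (Ideal.homogeneousCore (homogeneousSubmodule (Fin 3) ℂ) P).toIdeal
  have hcP : c ≤ P := Ideal.toIdeal_homogeneousCore_le _ _
  have hcp : c.IsPrime := hP.homogeneousCore
  have hhom : ∀ f t, IsHomogeneous f t → f ∈ P → f ∈ c := fun f t hf hfP =>
    Ideal.mem_homogeneousCore_of_homogeneous_of_mem ⟨t, hf⟩ hfP
  refine ⟨c, hcp, fun f hf => ?_, hcP, fun f hf => ?_, hhom⟩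
  · rw [← sum_homogeneousComponent f]
    refine sum_mem fun t _ => hhom _ t (homogeneousComponent_isHomogeneous t f) (hIP ?_)
    rw [homogeneousComponent_eq_formPart]
    exact hI f hf t
  · by_contra h0
    have h1 := (Ideal.homogeneousCore (homogeneousSubmodule (Fin 3) ℂ) P).isHomogeneous 0 hf
    have h2 : C (coeff 0 f) ∈ c := by
      rw [← homogeneousComponent_zero, ← decomposition.decompose'_apply]
      exact h1
    refine hcp.ne_top (c.eq_top_of_isUnit_mem h2 ?_)
    exact (isUnit_iff_ne_zero.2 h0).map C

theorem exists_isGoodLine {I : Ideal (MvPolynomial (Fin 3) ℂ)} (hI : IsGradedIdeal I)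
    (hdim : IsZeroDimIdeal I) : ∃ p k, IsGoodLine (lineForm p) k I := by
  have hfin : {q ∈ I.minimalPrimes | ∃ i, X i ∉ q}.Finite :=
    (Ideal.finite_minimalPrimes_of_isNoetherianRing _ I).subset fun _ h => h.1
  obtain ⟨p, hp⟩ := exists_lineForm_notMem hfin fun q hq => hq.2
  have hX : ∀ P : Ideal (MvPolynomial (Fin 3) ℂ), P.IsPrime → I ≤ P → lineForm p ∈ P →
      ∀ i, X i ∈ P := by
    intro P hP hIP hLP
    by_contra! hi
    obtain ⟨i, hi⟩ := hi
    obtain ⟨c, hcp, hIc, hcP, hc0, hc⟩ := exists_isPrime_graded_le hI hIP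
    have hLc : lineForm p ∈ c := hc _ 1 ((isForm_natCast_iff (m := 1)).1 (isForm_lineForm p)) hLP
    obtain ⟨q, hq, hqc⟩ := Ideal.exists_minimalPrimes_le hIc
    have hic : X i ∉ c := fun h => hi (hcP h)
    have hLq : lineForm p ∉ q := hp q ⟨hq, i, fun h => hic (hqc h)⟩
    have hqp : q.IsPrime := hq.1.1
    have hmp : (RingHom.ker (constantCoeff (R := ℂ) (σ := Fin 3))).IsPrime :=
      RingHom.ker_isPrime _
    unfold IsZeroDimIdeal at hdim
    rw [ringKrullDim_quotient] at hdim
    have h1 := Order.krullDim_le_one_iff.1 hdim.le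
    let xq : PrimeSpectrum.zeroLocus (I : Set (MvPolynomial (Fin 3) ℂ)) := ⟨⟨q, hqp⟩, hq.1.2⟩
    let xc : PrimeSpectrum.zeroLocus (I : Set (MvPolynomial (Fin 3) ℂ)) := ⟨⟨c, hcp⟩, hIc⟩
    let xm : PrimeSpectrum.zeroLocus (I : Set (MvPolynomial (Fin 3) ℂ)) :=
      ⟨⟨_, hmp⟩, fun _ h => hc0 (hIc h)⟩
    have hle1 : xq ≤ xc := hqc
    have hle2 : xc ≤ xm := hc0
    rcases h1 xc with h | h
    · have : c ≤ q := h hle1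
      exact hLq (this hLc)
    · have : RingHom.ker (constantCoeff (R := ℂ) (σ := Fin 3)) ≤ c := h hle2
      exact hic (this (by simp [RingHom.mem_ker]))
  have hrad : Ideal.span (Set.range (X : Fin 3 → MvPolynomial (Fin 3) ℂ)) ≤
      (I ⊔ Ideal.span {lineForm p}).radical := by
    rw [Ideal.radical_eq_sInf, Ideal.span_le]
    rintro _ ⟨i, rfl⟩
    refine Ideal.mem_sInf.2 fun {P} hP => ?_
    exact hX P hP.2 (le_sup_left.trans hP.1)
      (hP.1 (le_sup_right (a := I) (Ideal.mem_span_singleton_self _))) i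
  obtain ⟨k, hk⟩ := Ideal.exists_pow_le_of_le_radical_of_fg hrad
    ⟨Finset.univ.image X, by simp⟩
  refine ⟨p, k, fun s hs => hk ?_⟩
  have h1 : (monomial s 1 : MvPolynomial (Fin 3) ℂ) = ∏ i, X i ^ s i := by
    rw [monomial_eq, C_1, one_mul, Finsupp.prod_fintype _ _ fun i => pow_zero _]
  rw [h1, ← hs, Finsupp.degree_eq_sum, ← Finset.prod_pow_eq_pow_sum]
  exact Ideal.prod_mem_prod fun i _ =>
    Ideal.pow_mem_pow (Ideal.subset_span (Set.mem_range_self i)) _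

/-- The space of forms of degree `m : ℤ`. -/
def formSubmodule (σ : Type) (m : ℤ) : Submodule ℂ (MvPolynomial σ ℂ) where
  carrier := {f | IsForm f m}
  add_mem' := IsForm.add
  zero_mem' := IsForm.zero m
  smul_mem' a _ := IsForm.smul a

lemma mem_formSubmodule {σ : Type} {m : ℤ} {f : MvPolynomial σ ℂ} :
    f ∈ formSubmodule σ m ↔ IsForm f m := Iff.rfl

lemma formSubmodule_natCast (σ : Type) (m : ℕ) :
    formSubmodule σ m = homogeneousSubmodule σ ℂ m :=
  Submodule.ext fun _ => isForm_natCast_iff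

instance finite_formSubmodule (σ : Type) [Finite σ] (m : ℤ) :
    Module.Finite ℂ (formSubmodule σ m) := by
  rcases le_or_gt 0 m with hm | hm
  · lift m to ℕ using hm
    rw [formSubmodule_natCast]
    exact Module.Finite.iff_fg.2 (homogeneousSubmodule_fg σ ℂ m)
  · have : formSubmodule σ m = ⊥ := by
      rw [eq_bot_iff]
      intro f hf
      ext s
      by_contra hs
      have := hf s (by simpa using hs)
      omega
    rw [this]
    infer_instance

section

variable {n : ℕ} {b : Fin n → ℤ} {a : Fin (n + 1) → ℤ}
  {B : Matrix (Fin n) (Fin (n + 1)) (MvPolynomial (Fin 2) ℂ)}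

/-- The map `u ↦ u ᵥ* B` on vectors of forms. -/
noncomputable def vecMulForm (hB : ∀ i j, IsForm (B i j) (b i - a j)) :
    (∀ i, formSubmodule (Fin 2) (-b i)) →ₗ[ℂ] ∀ j, formSubmodule (Fin 2) (-a j) where
  toFun u j := ⟨((fun i => (u i : MvPolynomial (Fin 2) ℂ)) ᵥ* B) j, IsForm.sum fun i _ => by
    have := (mem_formSubmodule.1 (u i).2).mul (hB i j)
    rwa [neg_add_eq_sub, sub_sub_cancel_left] at this⟩
  map_add' u v := by
    ext1 j
    ext1
    exact congrFun (add_vecMul B _ _) j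
  map_smul' c u := by
    ext1 j
    ext1
    exact congrFun (smul_vecMul c _ B) j

lemma isForm_zero_eq_zero_or_isUnit {σ : Type} {f : MvPolynomial σ ℂ} (hf : IsForm f 0) :
    f = 0 ∨ IsUnit f := by
  have : f = C (coeff 0 f) := by
    classical
    ext s
    rw [coeff_C]
    split_ifs with h
    · rw [h]
    · by_contra hs
      have := hf s hs
      exact h ((Finsupp.degree_eq_zero_iff s).1 (by exact_mod_cast this)).symm
  rcases eq_or_ne (coeff 0 f) 0 with h | h
  · exact Or.inl (by rw [this, h, C_0])
  · exact Or.inr (this ▸ (isUnit_iff_ne_zero.2 h).map C)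

lemma signedMinorsIdeal_ne_top_of_ne_top {p : Fin 2 → ℂ} {k : ℕ}
    {A A₀ : Matrix (Fin n) (Fin (n + 1)) (MvPolynomial (Fin 3) ℂ)}
    (hab : ∑ i, b i = ∑ j, a j)
    (hA : ∀ i j, IsForm (A i j) (b i - a j)) (hA₀ : ∀ i j, IsForm (A₀ i j) (b i - a j))
    (h : IsGoodLine (lineForm p) k (signedMinorsIdeal A))
    (h₀ : IsGoodLine (lineForm p) k (signedMinorsIdeal A₀))
    (hne : signedMinorsIdeal A₀ ≠ ⊤) : signedMinorsIdeal A ≠ ⊤ := by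
  have hB : ∀ i j, IsForm ((A.map (restrictLine p)) i j) (b i - a j) :=
    fun i j => isForm_restrictLine p (hA i j)
  have hB₀ : ∀ i j, IsForm ((A₀.map (restrictLine p)) i j) (b i - a j) :=
    fun i j => isForm_restrictLine p (hA₀ i j)
  have hsurj : Function.Surjective (vecMulForm hB₀) := by
    intro c
    have hform : IsForm (∑ j, (c j : MvPolynomial (Fin 2) ℂ) *
        signedMinor (A₀.map (restrictLine p)) j) 0 := IsForm.sum fun j _ => by
      simpa using (mem_formSubmodule.1 (c j).2).mul (isForm_signedMinor hab hB₀ j)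
    have hzero : ∑ j, (c j : MvPolynomial (Fin 2) ℂ) *
        signedMinor (A₀.map (restrictLine p)) j = 0 := by
      refine (isForm_zero_eq_zero_or_isUnit hform).resolve_right fun hu => ?_
      refine sup_span_singleton_ne_top (isGradedIdeal_signedMinorsIdeal
        (isForm_signedMinor hab hA₀)) (isForm_lineForm p) hne ?_
      let f := ∑ j, rename Fin.succ (c j : MvPolynomial (Fin 2) ℂ) * signedMinor A₀ j
      have hf : f ∈ signedMinorsIdeal A₀ := mem_signedMinorsIdeal.2 ⟨_, rfl⟩
      have hr : restrictLine p f = ∑ j, (c j : MvPolynomial (Fin 2) ℂ) *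
          signedMinor (A₀.map (restrictLine p)) j := by
        rw [map_sum]
        refine Finset.sum_congr rfl fun j _ => ?_
        rw [map_mul, restrictLine_rename]
        congr 1
        exact map_signedMinor (restrictLine p).toRingHom A₀ j
      rw [← hr] at hu
      refine Ideal.eq_top_of_isUnit_mem _ ?_ (hu.map (rename (R := ℂ) Fin.succ))
      rw [← sub_sub_cancel f (rename Fin.succ (restrictLine p f))]
      exact sub_mem (Ideal.mem_sup_left hf) (Ideal.mem_sup_right (Ideal.mem_span_singleton.2
        (lineForm_dvd_sub_rename_restrictLine p f)))
    obtain ⟨w, hw⟩ := h₀.exists_eq_vecMul hzero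
    refine ⟨fun i => ⟨formPart (-b i) (w i), isForm_formPart _ _⟩, ?_⟩
    ext1 j
    ext1
    change ∑ i, formPart (-b i) (w i) * (A₀.map (restrictLine p)) i j = c j
    rw [← (mem_formSubmodule.1 (c j).2).formPart_eq, congrFun hw j]
    simp only [vecMul, dotProduct, map_sum]
    refine Finset.sum_congr rfl fun i _ => ?_
    rw [formPart_mul _ _ _ (hB₀ i j)]
    congr 2
    ring_nf
  have hinj : Function.Injective (vecMulForm hB) := by
    rw [injective_iff_map_eq_zero]
    intro u hu
    have := eq_zero_of_vecMul_eq_zero_of_mem (pow_ne_zero k (X_ne_zero 0)) (h.X_pow_mem 0)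
      (w := fun i => (u i : MvPolynomial (Fin 2) ℂ))
      (funext fun j => congrArg Subtype.val (congrFun hu j))
    ext1 i
    ext1
    exact congrFun this i
  have hsurj' : Function.Surjective (vecMulForm hB) :=
    (LinearMap.injective_iff_surjective_of_finrank_eq_finrank
      (le_antisymm (LinearMap.finrank_le_finrank_of_injective hinj)
        (LinearMap.finrank_le_finrank_of_surjective hsurj))).1 hinj
  intro htop
  have h1 : (1 : MvPolynomial (Fin 2) ℂ) ∈ signedMinorsIdeal (A.map (restrictLine p)) := by
    rw [← map_one (restrictLine p)]
    exact restrictLine_mem_of_mem_sup (by simp [htop])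
  obtain ⟨c, hc⟩ := mem_signedMinorsIdeal.1 h1
  obtain ⟨g, hg, hg1⟩ := exists_isForm_sum_mul_eq (isForm_signedMinor hab hB)
    (F := 1) (d := 0) (by simpa using IsForm.C (σ := Fin 2) (1 : ℂ)) hc.symm
  simp only [zero_sub] at hg
  obtain ⟨u, hu⟩ := hsurj' fun j => ⟨g j, hg j⟩
  have h2 := sum_vecMul_mul_signedMinor (A.map (restrictLine p))
    fun i => (u i : MvPolynomial (Fin 2) ℂ)
  have h3 : (fun i => (u i : MvPolynomial (Fin 2) ℂ)) ᵥ* A.map (restrictLine p) = g :=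
    funext fun j => congrArg Subtype.val (congrFun hu j)
  rw [h3, ← hg1] at h2
  exact one_ne_zero h2

end

section

variable {I : Ideal (MvPolynomial (Fin 3) ℂ)} {L : MvPolynomial (Fin 3) ℂ}

lemma finite_homogeneousSubmodule (t : ℕ) :
    Module.Finite ℂ (homogeneousSubmodule (Fin 3) ℂ t) :=
  Module.Finite.iff_fg.2 (homogeneousSubmodule_fg _ _ t)

lemma map_mulLeft_homogeneousSubmodule_le (hL : IsForm L 1) (t : ℕ) :
    (homogeneousSubmodule (Fin 3) ℂ t).map (LinearMap.mulLeft ℂ L) ≤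
      homogeneousSubmodule (Fin 3) ℂ (t + 1) := by
  rintro _ ⟨f, hf, rfl⟩
  rw [add_comm]
  exact (isForm_natCast_iff.1 (by exact_mod_cast hL) : IsHomogeneous L 1).mul hf

lemma hilbFn_add_finrank_sup (hL : IsForm L 1) (hL0 : L ≠ 0) (hreg : ∀ f, L * f ∈ I → f ∈ I)
    (t : ℕ) : hilbFn I t + Module.finrank ℂ (I.restrictScalars ℂ ⊓
        homogeneousSubmodule (Fin 3) ℂ (t + 1) : Submodule ℂ _) =
      Module.finrank ℂ ((homogeneousSubmodule (Fin 3) ℂ t).map (LinearMap.mulLeft ℂ L) ⊔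
        I.restrictScalars ℂ ⊓ homogeneousSubmodule (Fin 3) ℂ (t + 1) : Submodule ℂ _) := by
  have := finite_homogeneousSubmodule t
  have := finite_homogeneousSubmodule (t + 1)
  have hinj : Function.Injective (LinearMap.mulLeft ℂ L) := fun f g => mul_left_cancel₀ hL0
  have hinf : (homogeneousSubmodule (Fin 3) ℂ t).map (LinearMap.mulLeft ℂ L) ⊓
      (I.restrictScalars ℂ ⊓ homogeneousSubmodule (Fin 3) ℂ (t + 1)) =
      (I.restrictScalars ℂ ⊓ homogeneousSubmodule (Fin 3) ℂ t).map (LinearMap.mulLeft ℂ L) := by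
    apply le_antisymm
    · rintro _ ⟨⟨f, hf, rfl⟩, hI, -⟩
      exact ⟨f, ⟨hreg f hI, hf⟩, rfl⟩
    · rintro _ ⟨f, ⟨hI, hf⟩, rfl⟩
      exact ⟨⟨f, hf, rfl⟩, I.mul_mem_left L hI,
        map_mulLeft_homogeneousSubmodule_le hL t ⟨f, hf, rfl⟩⟩
  have h1 := Submodule.finrank_sup_add_finrank_inf_eq
    ((homogeneousSubmodule (Fin 3) ℂ t).map (LinearMap.mulLeft ℂ L))
    (I.restrictScalars ℂ ⊓ homogeneousSubmodule (Fin 3) ℂ (t + 1))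
  rw [hinf, ← (Submodule.equivMapOfInjective _ hinj _).finrank_eq,
    ← (Submodule.equivMapOfInjective _ hinj _).finrank_eq] at h1
  have h2 := Submodule.finrank_mono (inf_le_right :
    I.restrictScalars ℂ ⊓ homogeneousSubmodule (Fin 3) ℂ t ≤ _)
  unfold hilbFn
  omega

lemma map_mulLeft_sup_le (hL : IsForm L 1) (t : ℕ) :
    (homogeneousSubmodule (Fin 3) ℂ t).map (LinearMap.mulLeft ℂ L) ⊔
      I.restrictScalars ℂ ⊓ homogeneousSubmodule (Fin 3) ℂ (t + 1) ≤
    homogeneousSubmodule (Fin 3) ℂ (t + 1) :=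
  sup_le (map_mulLeft_homogeneousSubmodule_le hL t) inf_le_right

lemma hilbFn_le_succ (hL : IsForm L 1) (hL0 : L ≠ 0) (hreg : ∀ f, L * f ∈ I → f ∈ I)
    (t : ℕ) : hilbFn I t ≤ hilbFn I (t + 1) := by
  have := finite_homogeneousSubmodule (t + 1)
  have h1 := hilbFn_add_finrank_sup hL hL0 hreg t
  have h2 := Submodule.finrank_mono (map_mulLeft_sup_le (I := I) hL t)
  conv_rhs => unfold hilbFn
  omega

lemma exists_eq_mul_add_of_hilbFn_eq (hL : IsForm L 1) (hL0 : L ≠ 0)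
    (hreg : ∀ f, L * f ∈ I → f ∈ I) {t : ℕ} (h : hilbFn I t = hilbFn I (t + 1))
    {f : MvPolynomial (Fin 3) ℂ} (hf : f.IsHomogeneous (t + 1)) :
    ∃ q, IsHomogeneous q t ∧ ∃ g ∈ I, f = L * q + g := by
  have := finite_homogeneousSubmodule (t + 1)
  have h1 := hilbFn_add_finrank_sup hL hL0 hreg t
  have h2 := Submodule.finrank_mono (inf_le_right :
    I.restrictScalars ℂ ⊓ homogeneousSubmodule (Fin 3) ℂ (t + 1) ≤ _)
  rw [h] at h1
  unfold hilbFn at h1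
  have h3 := Submodule.eq_of_le_of_finrank_le (map_mulLeft_sup_le (I := I) hL t) (by omega)
  have hf' : f ∈ homogeneousSubmodule (Fin 3) ℂ (t + 1) := hf
  rw [← h3] at hf'
  obtain ⟨_, ⟨q, hq, rfl⟩, g, hg, rfl⟩ := Submodule.mem_sup.1 hf'
  exact ⟨q, hq, g, hg.1, rfl⟩

end

/-- The exponents of the monomials of degree `m : ℤ` in three variables. -/
noncomputable def degFinset (m : ℤ) : Finset (Fin 3 →₀ ℕ) :=
  {s ∈ (Finsupp.finite_of_degree_le m.toNat).toFinset | (s.degree : ℤ) = m}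

lemma mem_degFinset {m : ℤ} {s : Fin 3 →₀ ℕ} : s ∈ degFinset m ↔ (s.degree : ℤ) = m := by
  simp only [degFinset, Finset.mem_filter, Set.Finite.mem_toFinset, Set.mem_ofPred_eq]
  omega

lemma IsForm.coeff_eq_zero {T : Type} [CommRing T] {f : MvPolynomial (Fin 3) T} {m : ℤ}
    (hf : IsForm f m) {s : Fin 3 →₀ ℕ} (hs : s ∉ degFinset m) : coeff s f = 0 :=
  by_contra fun h => hs (mem_degFinset.2 (hf s h))

lemma IsForm.ext {T : Type} [CommRing T] {f g : MvPolynomial (Fin 3) T} {m : ℤ}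
    (hf : IsForm f m) (hg : IsForm g m) (h : ∀ s : degFinset m, coeff s.1 f = coeff s.1 g) :
    f = g := by
  ext s
  by_cases hs : s ∈ degFinset m
  · exact h ⟨s, hs⟩
  · rw [hf.coeff_eq_zero hs, hg.coeff_eq_zero hs]

section

variable {κ : Type} {T T' : Type} [CommRing T] [CommRing T']

/-- Indices for the coefficients of a family of forms of degrees `e`. -/
abbrev FormCoeffs (e : κ → ℤ) : Type := Σ i, degFinset (e i)

/-- The family of forms of degrees `e` with coefficients `v`. -/
noncomputable def formOfCoeffs (e : κ → ℤ) (v : FormCoeffs e → T) (i : κ) :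
    MvPolynomial (Fin 3) T :=
  ∑ s : degFinset (e i), monomial s.1 (v ⟨i, s⟩)

lemma isForm_formOfCoeffs (e : κ → ℤ) (v : FormCoeffs e → T) (i : κ) :
    IsForm (formOfCoeffs e v i) (e i) :=
  IsForm.sum fun s _ => IsForm.monomial (mem_degFinset.1 s.2) _

lemma coeff_formOfCoeffs (e : κ → ℤ) (v : FormCoeffs e → T) (i : κ) (s : degFinset (e i)) :
    coeff s.1 (formOfCoeffs e v i) = v ⟨i, s⟩ := by
  classical
  rw [formOfCoeffs, coeff_sum, Finset.sum_eq_single s]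
  · rw [coeff_monomial, if_pos rfl]
  · intro t _ hts
    rw [coeff_monomial, if_neg fun h => hts (Subtype.ext h)]
  · simp

lemma map_formOfCoeffs (φ : T →+* T') (e : κ → ℤ) (v : FormCoeffs e → T) (i : κ) :
    map φ (formOfCoeffs e v i) = formOfCoeffs e (fun x => φ (v x)) i := by
  simp [formOfCoeffs, map_monomial]

lemma formOfCoeffs_coeff {e : κ → ℤ} {f : κ → MvPolynomial (Fin 3) T}
    (hf : ∀ i, IsForm (f i) (e i)) (i : κ) :
    formOfCoeffs e (fun x => coeff x.2.1 (f x.1)) i = f i :=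
  (isForm_formOfCoeffs e _ i).ext (hf i) fun s => coeff_formOfCoeffs e _ i s

end

section

variable {n : ℕ} (b : Fin n → ℤ) (a : Fin (n + 1) → ℤ) {T T' : Type} [CommRing T] [CommRing T']

/-- The degree of an entry of a matrix of forms. -/
def entryDeg (x : Fin n × Fin (n + 1)) : ℤ := b x.1 - a x.2

/-- The matrix of forms with coefficients `v`. -/
noncomputable def matOfCoeffs (v : FormCoeffs (entryDeg b a) → T) :
    Matrix (Fin n) (Fin (n + 1)) (MvPolynomial (Fin 3) T) :=
  of fun i j => formOfCoeffs (entryDeg b a) v (i, j)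

variable {b a}

lemma isForm_matOfCoeffs (v : FormCoeffs (entryDeg b a) → T) (i : Fin n) (j : Fin (n + 1)) :
    IsForm (matOfCoeffs b a v i j) (b i - a j) :=
  isForm_formOfCoeffs (entryDeg b a) v (i, j)

lemma map_matOfCoeffs (φ : T →+* T') (v : FormCoeffs (entryDeg b a) → T) :
    (matOfCoeffs b a v).map (map φ) = matOfCoeffs b a fun x => φ (v x) := by
  ext1 i j
  exact map_formOfCoeffs φ _ v (i, j)

lemma map_signedMinor_matOfCoeffs (φ : T →+* T') (v : FormCoeffs (entryDeg b a) → T)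
    (j : Fin (n + 1)) : map φ (signedMinor (matOfCoeffs b a v) j) =
      signedMinor (matOfCoeffs b a fun x => φ (v x)) j := by
  rw [map_signedMinor, map_matOfCoeffs]

lemma exists_matOfCoeffs_eq {A : Matrix (Fin n) (Fin (n + 1)) (MvPolynomial (Fin 3) T)}
    (hA : ∀ i j, IsForm (A i j) (b i - a j)) : ∃ v, matOfCoeffs b a v = A := by
  refine ⟨fun x => coeff x.2.1 (A x.1.1 x.1.2), ?_⟩
  ext1 i j
  exact formOfCoeffs_coeff (e := entryDeg b a) (f := fun x => A x.1 x.2)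
    (fun x => hA x.1 x.2) (i, j)

theorem exists_isGoodLine_of_eval_ne_zero {L : MvPolynomial (Fin 3) ℂ} {k : ℕ}
    (hab : ∑ i, b i = ∑ j, a j) (hL : IsForm L 1) {v₀ : FormCoeffs (entryDeg b a) → ℂ}
    (h₀ : IsGoodLine L k (signedMinorsIdeal (matOfCoeffs b a v₀))) :
    ∃ h : MvPolynomial (FormCoeffs (entryDeg b a)) ℂ, eval v₀ h ≠ 0 ∧
      ∀ v, eval v h ≠ 0 → IsGoodLine L k (signedMinorsIdeal (matOfCoeffs b a v)) := by
  have hM : ∀ v : FormCoeffs (entryDeg b a) → ℂ, ∀ j,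
      IsForm (signedMinor (matOfCoeffs b a v) j) (a j) :=
    fun v => isForm_signedMinor hab (isForm_matOfCoeffs v)
  have hdec : ∀ s : degFinset (k : ℤ), ∃ (g : Fin (n + 1) → MvPolynomial (Fin 3) ℂ) (q : _),
      (∀ j, IsForm (g j) (k - a j)) ∧ IsForm q (k - 1 : ℤ) ∧
      monomial s.1 1 = ∑ j, g j * signedMinor (matOfCoeffs b a v₀) j + L * q := by
    intro s
    have hs := mem_degFinset.1 s.2
    obtain ⟨f, hf, q, hfk, hq, heq⟩ := mem_sup_span_singleton_form
      (isGradedIdeal_signedMinorsIdeal (hM v₀)) hL (IsForm.monomial hs 1)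
      (h₀ s.1 (by exact_mod_cast hs))
    obtain ⟨c, hc⟩ := mem_signedMinorsIdeal.1 hf
    obtain ⟨g, hg, rfl⟩ := exists_isForm_sum_mul_eq (hM v₀) hfk hc.symm
    exact ⟨g, q, hg, hq, heq⟩
  choose g q hg hq heq using hdec
  let G (v : FormCoeffs (entryDeg b a) → ℂ) (s : degFinset (k : ℤ)) : MvPolynomial (Fin 3) ℂ :=
    ∑ j, g s j * signedMinor (matOfCoeffs b a v) j + L * q s
  let N (v : FormCoeffs (entryDeg b a) → ℂ) : Matrix (degFinset (k : ℤ)) (degFinset (k : ℤ)) ℂ :=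
    of fun s s' => coeff s'.1 (G v s)
  let N' : Matrix (degFinset (k : ℤ)) (degFinset (k : ℤ))
      (MvPolynomial (FormCoeffs (entryDeg b a)) ℂ) :=
    of fun s s' => coeff s'.1
      (∑ j, map C (g s j) * signedMinor (matOfCoeffs b a X) j + map C (L * q s))
  have hmapC : ∀ (v : FormCoeffs (entryDeg b a) → ℂ) (f : MvPolynomial (Fin 3) ℂ),
      map (eval v) (map C f) = f := fun v f => by
    rw [MvPolynomial.map_map]
    convert MvPolynomial.map_id f
    ext x
    simp
  have hN : ∀ v, eval v N'.det = (N v).det := by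
    intro v
    rw [RingHom.map_det]
    congr 1
    ext s s'
    simp only [RingHom.mapMatrix_apply, map_apply, N', N, G, of_apply]
    rw [← coeff_map, map_add, map_sum, hmapC]
    simp only [map_mul, hmapC, map_signedMinor_matOfCoeffs, eval_X]
  have hG : ∀ v s, IsForm (G v s) k := by
    intro v s
    refine IsForm.add (IsForm.sum fun j _ => ?_) ?_
    · simpa using (hg s j).mul (hM v j)
    · simpa using hL.mul (hq s)
  refine ⟨N'.det, ?_, fun v hv => ?_⟩
  · have : N v₀ = 1 := by
      ext s s'
      simp only [N, G, of_apply, ← heq, one_apply, coeff_monomial, Subtype.ext_iff]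
    rw [hN, this, det_one]
    exact one_ne_zero
  · intro t ht
    rw [hN] at hv
    let t' : degFinset (k : ℤ) := ⟨t, mem_degFinset.2 (by exact_mod_cast ht)⟩
    have hinv : (N v)⁻¹ * N v = 1 := nonsing_inv_mul _ (isUnit_iff_ne_zero.2 hv)
    have hmon : monomial t 1 = ∑ s, C ((N v)⁻¹ t' s) * G v s := by
      refine (IsForm.monomial (mem_degFinset.1 t'.2) 1).ext
        (IsForm.sum fun s _ => (hG v s).C_mul _) fun s' => ?_
      rw [coeff_sum]
      simp only [coeff_C_mul]
      have := congrFun (congrFun hinv t') s'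
      rw [mul_apply, one_apply] at this
      simp only [N, of_apply] at this
      rw [this, coeff_monomial]
      simp only [t', Subtype.ext_iff]
    rw [hmon]
    refine sum_mem fun s _ => Ideal.mul_mem_left _ _ (add_mem (Ideal.mem_sup_left ?_)
      (Ideal.mem_sup_right (Ideal.mem_span_singleton.2 ⟨_, rfl⟩)))
    exact sum_mem fun j _ => Ideal.mul_mem_left _ _ (signedMinor_mem _ j)

end

lemma coeff_map_mul_eq_sum {T : Type} [CommRing T] (φ : ℂ →+* T) (L : MvPolynomial (Fin 3) ℂ)
    {F : MvPolynomial (Fin 3) T} {m : ℤ} (hF : IsForm F m) (s : Fin 3 →₀ ℕ) :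
    coeff s (map φ L * F) =
      ∑ t : degFinset m, φ (coeff s (L * monomial t.1 1)) * coeff t.1 F := by
  have h1 : F = ∑ t : degFinset m, monomial t.1 (coeff t.1 F) :=
    (formOfCoeffs_coeff (e := fun _ : Unit => m) (f := fun _ => F) (fun _ => hF) ()).symm
  conv_lhs => rw [h1, Finset.mul_sum, coeff_sum]
  refine Finset.sum_congr rfl fun t _ => ?_
  rw [← coeff_map, map_mul, map_monomial, map_one, mul_comm _ (coeff t.1 F), ← coeff_C_mul,
    mul_left_comm, C_mul_monomial, mul_one]

section

variable {n : ℕ} (b : Fin n → ℤ) (a : Fin (n + 1) → ℤ) {T T' : Type} [CommRing T] [CommRing T']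

/-- Indices for the coefficients of a matrix of forms together with cofactors for
a combination of degree `d` of its maximal minors. -/
abbrev CurveParams (d : ℤ) : Type :=
  FormCoeffs (entryDeg b a) ⊕ FormCoeffs (fun j => d - a j)

variable {b a}

/-- The combination of maximal minors with parameters `v`. -/
noncomputable def curveForm {d : ℤ} (v : CurveParams b a d → T) : MvPolynomial (Fin 3) T :=
  ∑ j, formOfCoeffs (fun j => d - a j) (fun x => v (Sum.inr x)) j *
    signedMinor (matOfCoeffs b a fun x => v (Sum.inl x)) j

lemma isForm_curveForm (hab : ∑ i, b i = ∑ j, a j) {d : ℤ} (v : CurveParams b a d → T) :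
    IsForm (curveForm v) d :=
  IsForm.sum fun j _ => by
    simpa using (isForm_formOfCoeffs (fun j => d - a j) (fun x => v (Sum.inr x)) j).mul
      (isForm_signedMinor hab (isForm_matOfCoeffs fun x => v (Sum.inl x)) j)

lemma map_curveForm (φ : T →+* T') {d : ℤ} (v : CurveParams b a d → T) :
    map φ (curveForm v) = curveForm fun x => φ (v x) := by
  simp only [curveForm, map_sum, map_mul, map_formOfCoeffs, map_signedMinor_matOfCoeffs]

lemma curveForm_mem {d : ℤ} (v : CurveParams b a d → T) :
    curveForm v ∈ signedMinorsIdeal (matOfCoeffs b a fun x => v (Sum.inl x)) :=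
  mem_signedMinorsIdeal.2 ⟨_, rfl⟩

variable (b a) in
/-- The coefficients of `curveForm`, as polynomials in the parameters. -/
noncomputable def curveCoeff (d : ℤ) (s : degFinset d) : MvPolynomial (CurveParams b a d) ℂ :=
  coeff s.1 (curveForm (X : CurveParams b a d → MvPolynomial (CurveParams b a d) ℂ))

lemma aeval_curveCoeff [Algebra ℂ T] {d : ℤ} (v : CurveParams b a d → T) (s : degFinset d) :
    aeval v (curveCoeff b a d s) = coeff s.1 (curveForm v) := by
  have h := coeff_map (aeval (R := ℂ) v).toRingHom
    (curveForm (X : CurveParams b a d → MvPolynomial (CurveParams b a d) ℂ)) s.1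
  rw [map_curveForm] at h
  simp only [AlgHom.toRingHom_eq_coe, RingHom.coe_coe, aeval_X] at h
  exact h.symm

lemma eval_curveCoeff {d : ℤ} (v : CurveParams b a d → ℂ) (s : degFinset d) :
    eval v (curveCoeff b a d s) = coeff s.1 (curveForm v) := by
  rw [← aeval_curveCoeff, ← coe_aeval_eq_eval]
  rfl

lemma exists_curveForm_eq {d : ℤ} (hab : ∑ i, b i = ∑ j, a j)
    {A : Matrix (Fin n) (Fin (n + 1)) (MvPolynomial (Fin 3) ℂ)}
    (hA : ∀ i j, IsForm (A i j) (b i - a j)) {F : MvPolynomial (Fin 3) ℂ} (hF : IsForm F d)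
    (hFA : F ∈ signedMinorsIdeal A) : ∃ v : CurveParams b a d → ℂ, curveForm v = F := by
  obtain ⟨u, rfl⟩ := exists_matOfCoeffs_eq hA
  obtain ⟨c, hc⟩ := mem_signedMinorsIdeal.1 hFA
  obtain ⟨g, hg, rfl⟩ := exists_isForm_sum_mul_eq (isForm_signedMinor hab hA) hF hc.symm
  refine ⟨Sum.elim u fun x => coeff x.2.1 (g x.1), ?_⟩
  simp only [curveForm, Sum.elim_inr, Sum.elim_inl, formOfCoeffs_coeff hg]

lemma exists_isForm_coeff_eq {m : ℤ} (c : degFinset m → ℂ) :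
    ∃ f : MvPolynomial (Fin 3) ℂ, IsForm f m ∧ ∀ s : degFinset m, coeff s.1 f = c s :=
  ⟨formOfCoeffs (fun _ : Unit => m) (fun x => c x.2) (), isForm_formOfCoeffs _ _ _,
    fun s => coeff_formOfCoeffs (fun _ : Unit => m) (fun x => c x.2) () s⟩

lemma algebraicIndependent_curveCoeff {d : ℤ} {Φ : MvPolynomial (Fin 3 →₀ ℕ) ℂ}
    {f₀ : MvPolynomial (Fin 3) ℂ} (hf₀ : IsForm f₀ d) (hΦ₀ : eval f₀.coeff Φ ≠ 0)
    (hΦ : ∀ f : MvPolynomial (Fin 3) ℂ, IsForm f d → eval f.coeff Φ ≠ 0 →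
      ∃ v : CurveParams b a d → ℂ, curveForm v = f) :
    AlgebraicIndependent ℂ (curveCoeff b a d) := by
  let Ψ : MvPolynomial (degFinset d) ℂ :=
    aeval (fun s => if h : s ∈ degFinset d then X ⟨s, h⟩ else 0) Φ
  have hΨ : ∀ f : MvPolynomial (Fin 3) ℂ, IsForm f d →
      eval (fun s : degFinset d => coeff s.1 f) Ψ = eval f.coeff Φ := by
    intro f hf
    rw [← coe_aeval_eq_eval, ← coe_aeval_eq_eval]
    change ((aeval fun s : degFinset d => coeff s.1 f).comp (aeval _)) Φ = aeval f.coeff Φ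
    congr 1
    refine MvPolynomial.algHom_ext fun s => ?_
    rw [AlgHom.comp_apply, aeval_X, aeval_X]
    split_ifs with h
    · rw [aeval_X]
    · rw [map_zero]
      exact (hf.coeff_eq_zero h).symm
  have hΨ0 : Ψ ≠ 0 := fun h => hΦ₀ (by rw [← hΨ f₀ hf₀, h, map_zero])
  rw [algebraicIndependent_iff]
  intro F hF
  refine (mul_eq_zero.1 (MvPolynomial.funext fun c => ?_ : F * Ψ = 0)).resolve_right hΨ0
  rw [map_mul, map_zero, mul_eq_zero]
  obtain ⟨f, hf, hfc⟩ := exists_isForm_coeff_eq c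
  obtain rfl : (fun s : degFinset d => coeff s.1 f) = c := funext hfc
  by_cases h0 : eval f.coeff Φ = 0
  · exact Or.inr (by rw [hΨ f hf, h0])
  · obtain ⟨v, rfl⟩ := hΦ f hf h0
    left
    have := congrArg (eval v) hF
    rw [map_zero] at this
    rw [← this, ← coe_aeval_eq_eval, ← coe_aeval_eq_eval]
    simp only [← eval_curveCoeff, ← coe_aeval_eq_eval]
    change _ = ((aeval v).comp (aeval _)) F
    rw [comp_aeval]
    rfl

lemma jacobianMatrix_mul_of_aeval_eq {ι ι' τ τ' : Type} [Fintype ι] [Fintype τ']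
    {P : ι → MvPolynomial τ ℂ} {P' : ι' → MvPolynomial τ' ℂ} {μ : τ' → MvPolynomial τ ℂ}
    {N : Matrix ι' ι ℂ} (h : ∀ s, aeval μ (P' s) = ∑ t, C (N s t) * P t) (v : τ → ℂ) :
    (jacobianMatrix P').map (eval fun l => eval v (μ l)) * (jacobianMatrix μ).map (eval v) =
      N * (jacobianMatrix P).map (eval v) := by
  ext s l
  have h1 := congrArg (fun f => eval v (pderiv l f)) (h s)
  simp only [pderiv_aeval, map_sum, map_mul, pderiv_C_mul, eval_C] at h1
  simp only [mul_apply, jacobianMatrix, map_apply, of_apply]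
  rw [← h1]
  refine Finset.sum_congr rfl fun l' _ => ?_
  congr 1
  rw [← coe_aeval_eq_eval, ← coe_aeval_eq_eval]
  change _ = ((aeval v).comp (aeval μ)) _
  rw [comp_aeval]
  rfl

end

section

variable {n : ℕ} {b : Fin n → ℤ} {a : Fin (n + 1) → ℤ}

lemma exists_jacobianMatrix_mulVec_eq_mul {d : ℤ} (hab : ∑ i, b i = ∑ j, a j)
    {L : MvPolynomial (Fin 3) ℂ} (hL : IsForm L 1) {v : CurveParams b a d → ℂ}
    {W : Matrix (CurveParams b a d) (degFinset d) ℂ}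
    (hW : (jacobianMatrix (curveCoeff b a d)).map (eval v) * W = 1) :
    ∃ v' : CurveParams b a (d + 1) → ℂ, (∀ x, v' (Sum.inl x) = v (Sum.inl x)) ∧
      ∀ q, IsForm q d → ∃ y, (jacobianMatrix (curveCoeff b a (d + 1))).map (eval v') *ᵥ y =
        fun s => coeff s.1 (L * q) := by
  let G : Fin (n + 1) → MvPolynomial (Fin 3) (MvPolynomial (CurveParams b a d) ℂ) := fun j =>
    map C L * formOfCoeffs (fun j => d - a j) (fun x => X (Sum.inr x)) j
  have hG : ∀ j, IsForm (G j) (d + 1 - a j) := fun j => by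
    have := (hL.map (C (σ := CurveParams b a d))).mul
      (isForm_formOfCoeffs (fun j => d - a j)
        (fun x => (X (Sum.inr x) : MvPolynomial (CurveParams b a d) ℂ)) j)
    rwa [← add_sub_assoc, add_comm 1 d] at this
  let μ : CurveParams b a (d + 1) → MvPolynomial (CurveParams b a d) ℂ :=
    Sum.elim (fun x => X (Sum.inl x)) fun x => coeff x.2.1 (G x.1)
  have hμ : curveForm μ = map C L *
      curveForm (X : CurveParams b a d → MvPolynomial (CurveParams b a d) ℂ) := by
    simp only [curveForm, μ, Sum.elim_inr, Sum.elim_inl, formOfCoeffs_coeff hG, Finset.mul_sum, G,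
      mul_assoc]
  let N : Matrix (degFinset (d + 1)) (degFinset d) ℂ :=
    of fun s t => coeff s.1 (L * monomial t.1 1)
  have hN : ∀ s, aeval μ (curveCoeff b a (d + 1) s) = ∑ t, C (N s t) * curveCoeff b a d t := by
    intro s
    rw [aeval_curveCoeff, hμ, coeff_map_mul_eq_sum C L (isForm_curveForm hab X)]
    rfl
  refine ⟨fun l => eval v (μ l), fun x => eval_X _, fun q hq => ?_⟩
  refine ⟨(jacobianMatrix μ).map (eval v) *ᵥ (W *ᵥ fun t => coeff t.1 q), ?_⟩
  rw [mulVec_mulVec, jacobianMatrix_mul_of_aeval_eq hN, mulVec_mulVec, Matrix.mul_assoc, hW,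
    Matrix.mul_one]
  ext s
  have := coeff_map_mul_eq_sum (RingHom.id ℂ) L hq s.1
  rw [MvPolynomial.map_id] at this
  exact this.symm

lemma exists_jacobianMatrix_mulVec_eq_of_mem {d : ℤ} (hab : ∑ i, b i = ∑ j, a j)
    (v : CurveParams b a d → ℂ) {f : MvPolynomial (Fin 3) ℂ} (hf : IsForm f d)
    (hfA : f ∈ signedMinorsIdeal (matOfCoeffs b a fun x => v (Sum.inl x))) :
    ∃ y, (jacobianMatrix (curveCoeff b a d)).map (eval v) *ᵥ y =
      fun s => coeff s.1 f := by
  let γ := FormCoeffs (fun j => d - a j)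
  let M := signedMinor (matOfCoeffs b a fun x => v (Sum.inl x))
  let ν : CurveParams b a d → MvPolynomial γ ℂ := Sum.elim (fun x => C (v (Sum.inl x))) X
  let N : Matrix (degFinset d) γ ℂ := of fun s x => coeff s.1 (M x.1 * monomial x.2.1 1)
  have hν : curveForm ν = ∑ j, map C (M j) *
      formOfCoeffs (fun j => d - a j) (X : γ → MvPolynomial γ ℂ) j := by
    simp only [curveForm, ν, Sum.elim_inr, Sum.elim_inl, M, map_signedMinor_matOfCoeffs]
    exact Finset.sum_congr rfl fun j _ => mul_comm _ _
  have hN : ∀ s, aeval ν (curveCoeff b a d s) = ∑ x, C (N s x) * X x := by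
    intro s
    rw [aeval_curveCoeff, hν, coeff_sum, Fintype.sum_sigma]
    refine Finset.sum_congr rfl fun j _ => ?_
    rw [coeff_map_mul_eq_sum C (M j) (isForm_formOfCoeffs (fun j => d - a j) X j)]
    refine Finset.sum_congr rfl fun t _ => ?_
    exact congrArg (C (coeff s.1 (M j * monomial t.1 1)) * ·)
      (coeff_formOfCoeffs (fun j => d - a j) (X : γ → MvPolynomial γ ℂ) j t)
  obtain ⟨c, hc⟩ := mem_signedMinorsIdeal.1 hfA
  obtain ⟨g, hg, rfl⟩ := exists_isForm_sum_mul_eq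
    (isForm_signedMinor hab (isForm_matOfCoeffs fun x => v (Sum.inl x))) hf hc.symm
  have hv : (fun l => eval (fun x => v (Sum.inr x)) (ν l)) = v := by
    ext (x | x) <;> simp [ν]
  have h1 := jacobianMatrix_mul_of_aeval_eq hN fun x => v (Sum.inr x)
  have h2 : (jacobianMatrix (X : γ → MvPolynomial γ ℂ)).map (eval fun x => v (Sum.inr x)) = 1 := by
    classical
    ext x y
    simp only [jacobianMatrix, map_apply, of_apply, pderiv_X, one_apply, Pi.single_apply]
    split_ifs <;> simp_all
  rw [hv, h2, Matrix.mul_one] at h1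
  refine ⟨(jacobianMatrix ν).map (eval fun x => v (Sum.inr x)) *ᵥ
    fun x => coeff x.2.1 (g x.1), ?_⟩
  rw [mulVec_mulVec, h1]
  ext s
  rw [coeff_sum, mulVec, dotProduct, Fintype.sum_sigma]
  refine Finset.sum_congr rfl fun j _ => ?_
  have := coeff_map_mul_eq_sum (RingHom.id ℂ) (M j) (hg j) s.1
  rw [MvPolynomial.map_id] at this
  rw [mul_comm (g j)]
  exact this.symm

end

section

variable {n : ℕ} {b : Fin n → ℤ} {a : Fin (n + 1) → ℤ}

lemma hasDegMatrix_iff {Q : Matrix (Fin n) (Fin (n + 1)) ℤ} (hQ : ∀ i j, Q i j = b i - a j)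
    {A : Matrix (Fin n) (Fin (n + 1)) (MvPolynomial (Fin 3) ℂ)} :
    HasDegMatrix A Q ↔ ∀ i j, IsForm (A i j) (b i - a j) := by
  simp only [HasDegMatrix, isFormOfDeg_iff_isForm, hQ]

lemma exists_isGoodLine_signedMinorsIdeal (hab : ∑ i, b i = ∑ j, a j)
    {A : Matrix (Fin n) (Fin (n + 1)) (MvPolynomial (Fin 3) ℂ)}
    (hA : ∀ i j, IsForm (A i j) (b i - a j)) (hdim : IsZeroDimIdeal (minorsIdeal A)) :
    ∃ p k, IsGoodLine (lineForm p) k (signedMinorsIdeal A) :=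
  exists_isGoodLine (isGradedIdeal_signedMinorsIdeal (isForm_signedMinor hab hA))
    (by rwa [signedMinorsIdeal_eq_minorsIdeal])

lemma hilbFn_minorsIdeal_le_succ (hab : ∑ i, b i = ∑ j, a j)
    {A : Matrix (Fin n) (Fin (n + 1)) (MvPolynomial (Fin 3) ℂ)}
    (hA : ∀ i j, IsForm (A i j) (b i - a j)) (hdim : IsZeroDimIdeal (minorsIdeal A)) (t : ℕ) :
    hilbFn (minorsIdeal A) t ≤ hilbFn (minorsIdeal A) (t + 1) := by
  obtain ⟨p, k, h⟩ := exists_isGoodLine_signedMinorsIdeal hab hA hdim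
  rw [← signedMinorsIdeal_eq_minorsIdeal]
  exact hilbFn_le_succ (isForm_lineForm p) (lineForm_ne_zero p)
    (fun f => h.mem_of_lineForm_mul_mem) t

theorem generalForm_succ {Q : Matrix (Fin n) (Fin (n + 1)) ℤ}
    (hQ : ∀ i j, Q i j = b i - a j) (hab : ∑ i, b i = ∑ j, a j) {d : ℕ}
    (hHf : ∀ A : Matrix (Fin n) (Fin (n + 1)) (MvPolynomial (Fin 3) ℂ),
      HasDegMatrix A Q → IsZeroDimIdeal (minorsIdeal A) →
      hilbFn (minorsIdeal A) d = hilbFn (minorsIdeal A) (d + 1))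
    (hgen : GeneralForm 3 (d : ℤ) fun F =>
      ∃ A : Matrix (Fin n) (Fin (n + 1)) (MvPolynomial (Fin 3) ℂ),
        HasDegMatrix A Q ∧ IsZeroDimIdeal (minorsIdeal A) ∧ F ∈ minorsIdeal A) :
    GeneralForm 3 ((d + 1 : ℕ) : ℤ) fun F =>
      ∃ A : Matrix (Fin n) (Fin (n + 1)) (MvPolynomial (Fin 3) ℂ),
        HasDegMatrix A Q ∧ IsZeroDimIdeal (minorsIdeal A) ∧ F ∈ minorsIdeal A := by
  classical
  simp only [GeneralForm, hasDegMatrix_iff hQ, isFormOfDeg_iff_isForm,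
    ← signedMinorsIdeal_eq_minorsIdeal] at hHf hgen ⊢
  obtain ⟨Φ, ⟨f₀, hf₀, hΦ₀⟩, hΦ⟩ := hgen
  obtain ⟨A₀, hA₀, hdim₀, -⟩ := hΦ f₀ hf₀ hΦ₀
  obtain ⟨p, k, hline₀⟩ := exists_isGoodLine
    (isGradedIdeal_signedMinorsIdeal (isForm_signedMinor hab hA₀)) hdim₀
  obtain ⟨u₀, rfl⟩ := exists_matOfCoeffs_eq hA₀
  obtain ⟨h, hh₀, hh⟩ := exists_isGoodLine_of_eval_ne_zero hab (isForm_lineForm p) hline₀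
  have hzero : ∀ u, eval u h ≠ 0 → IsZeroDimIdeal (signedMinorsIdeal (matOfCoeffs b a u)) :=
    fun u hu => (hh u hu).isZeroDimIdeal
      (isGradedIdeal_signedMinorsIdeal (isForm_signedMinor hab (isForm_matOfCoeffs u)))
      (isForm_lineForm p)
      (signedMinorsIdeal_ne_top_of_ne_top hab (isForm_matOfCoeffs u) hA₀ (hh u hu) hline₀
        hdim₀.ne_top)
      fun _ => (hh u hu).mem_of_lineForm_mul_mem
  have heval : ∀ (e : ℤ) (v : CurveParams b a e → ℂ),
      eval v (rename Sum.inl h) = eval (fun x => v (Sum.inl x)) h := fun e v => eval_rename _ _ _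
  have hh0 : ∀ e : ℤ, (rename Sum.inl h : MvPolynomial (CurveParams b a e) ℂ) ≠ 0 := by
    intro e h0
    have := heval e (Sum.elim u₀ 0)
    rw [h0, map_zero] at this
    exact hh₀ this.symm
  have hP : AlgebraicIndependent ℂ (curveCoeff b a d) :=
    algebraicIndependent_curveCoeff hf₀ hΦ₀ fun f hf hfΦ => by
      obtain ⟨A, hA, -, hfA⟩ := hΦ f hf hfΦ
      exact exists_curveForm_eq hab hA hf hfA
  obtain ⟨v, hv, W, hW⟩ := exists_eval_jacobianMatrix_mul_eq_one hP (hh0 d)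
  rw [heval] at hv
  obtain ⟨v', hv', hJ⟩ := exists_jacobianMatrix_mulVec_eq_mul hab (isForm_lineForm p) hW
  have hsurj : Function.Surjective
      ((jacobianMatrix (curveCoeff b a ((d : ℤ) + 1))).map (eval v')).mulVec := by
    intro c
    obtain ⟨f, hf, hfc⟩ := exists_isForm_coeff_eq c
    obtain ⟨q, hq, g, hg, hfq⟩ := exists_eq_mul_add_of_hilbFn_eq (isForm_lineForm p)
      (lineForm_ne_zero p) (fun f => (hh _ hv).mem_of_lineForm_mul_mem)
      (hHf _ (isForm_matOfCoeffs _) (hzero _ hv))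
      (isForm_natCast_iff.1 (by exact_mod_cast hf) : IsHomogeneous f (d + 1))
    have hq' : IsForm q d := isForm_natCast_iff.2 hq
    have hg' : IsForm g ((d : ℤ) + 1) := by
      rw [eq_sub_of_add_eq' hfq.symm, add_comm]
      rw [add_comm] at hf
      exact hf.sub ((isForm_lineForm p).mul hq')
    obtain ⟨y, hy⟩ := hJ q hq'
    obtain ⟨z, hz⟩ := exists_jacobianMatrix_mulVec_eq_of_mem hab v' hg'
      (by simpa only [hv'] using hg)
    refine ⟨y + z, ?_⟩
    rw [mulVec_add, hy, hz]
    ext s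
    rw [Pi.add_apply, ← coeff_add, ← hfq, hfc]
  obtain ⟨W', hW'⟩ := mulVec_surjective_iff_exists_right_inverse.1 hsurj
  obtain ⟨Ψ, hΨ0, hΨ⟩ := exists_forall_eval_ne_zero_exists_of_algebraicIndependent
    (algebraicIndependent_of_jacobianMatrix _ v' W' hW') (hh0 (d + 1))
  push_cast
  refine ⟨rename Subtype.val Ψ, ?_, fun f hf hfΨ => ?_⟩
  · obtain ⟨c, hc⟩ : ∃ c, eval c Ψ ≠ 0 := by
      by_contra! hcon
      exact hΨ0 (MvPolynomial.funext fun c => by rw [hcon c, map_zero])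
    obtain ⟨f, hf, hfc⟩ := exists_isForm_coeff_eq c
    refine ⟨f, hf, ?_⟩
    rw [eval_rename]
    convert hc
    exact funext hfc
  · rw [eval_rename] at hfΨ
    obtain ⟨w, hw, hwf⟩ := hΨ _ hfΨ
    rw [heval] at hw
    refine ⟨_, isForm_matOfCoeffs _, hzero _ hw, ?_⟩
    have : curveForm w = f := (isForm_curveForm hab w).ext hf fun s => by
      rw [← eval_curveCoeff, hwf]
      rfl
    exact this ▸ curveForm_mem w

end

/-- (Theorem 4.2.)  Let `Q` be a homogeneous `n×(n+1)` integer matrix which is a dHB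
matrix of zero-dimensional subschemes of `ℙ²`, all of which have degree `δ` and Hilbert
function `Hf`.  If `Hf d = δ` and a general plane curve of degree `d` contains a
zero-dimensional subscheme with dHB matrix `Q`, then so does a general plane curve of
any degree `d' ≥ d`.  (A zero-dimensional subscheme with dHB matrix `Q` is encoded by a
matrix of forms `A` with degree matrix `Q` whose maximal minors generate its ideal.) -/
theorem stmt_8 {n : ℕ} (Q : Matrix (Fin n) (Fin (n + 1)) ℤ) (hQ : IsHomogMatrix Q)
    (δ : ℕ) (Hf : ℕ → ℕ)
    (hHf : ∀ A : Matrix (Fin n) (Fin (n + 1)) (MvPolynomial (Fin 3) ℂ),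
      HasDegMatrix A Q → IsZeroDimIdeal (minorsIdeal A) →
      ∀ t, hilbFn (minorsIdeal A) t = Hf t)
    (hδ : ∀ᶠ t in Filter.atTop, Hf t = δ)
    (d : ℕ) (hd : Hf d = δ)
    (hgen : GeneralForm 3 (d : ℤ) (fun F =>
      ∃ A : Matrix (Fin n) (Fin (n + 1)) (MvPolynomial (Fin 3) ℂ),
        HasDegMatrix A Q ∧ IsZeroDimIdeal (minorsIdeal A) ∧ F ∈ minorsIdeal A)) :
    ∀ d' : ℕ, d ≤ d' →
      GeneralForm 3 (d' : ℤ) (fun F =>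
        ∃ A : Matrix (Fin n) (Fin (n + 1)) (MvPolynomial (Fin 3) ℂ),
          HasDegMatrix A Q ∧ IsZeroDimIdeal (minorsIdeal A) ∧ F ∈ minorsIdeal A) := by
  obtain ⟨b, a, hba, hab⟩ := exists_degrees_of_isHomogMatrix hQ
  have hmono : Monotone Hf := by
    obtain ⟨Φ, ⟨f₀, hf₀, hΦ₀⟩, hΦ⟩ := hgen
    obtain ⟨A, hA, hdim, -⟩ := hΦ f₀ hf₀ hΦ₀
    refine monotone_nat_of_le_succ fun t => ?_
    rw [← hHf A hA hdim, ← hHf A hA hdim]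
    exact hilbFn_minorsIdeal_le_succ hab ((hasDegMatrix_iff hba).1 hA) hdim t
  have hconst : ∀ t, d ≤ t → Hf t = δ := by
    intro t ht
    obtain ⟨s, hs, hts⟩ := (hδ.and (Filter.eventually_ge_atTop t)).exists
    exact le_antisymm (hs ▸ hmono hts) (hd ▸ hmono ht)
  intro d' hd'
  induction d', hd' using Nat.le_induction with
  | base => exact hgen
  | succ t ht ih =>
    refine generalForm_succ hba hab (fun A hA hdim => ?_) ih
    rw [hHf A hA hdim, hHf A hA hdim, hconst t ht, hconst (t + 1) (by omega)]
end
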